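/- arXiv:math/9406224 — 2 statements merged into one kernel-verified Lean document; each statement's English description precedes it below -/
import Mathlib

section
/- Let (α_n) and (β_n) be sequences with α_n, β_n > −1, let (δ_n) and (ε_n) be real sequences with δ_n > 0, and let a_1, a_2 ∈ ℝ and b_1, b_2 > 0 be constants such that: (1/δ_n)·((n+β_n)/(2n+α_n+β_n) − ε_n) → a_1/2; (1/δ_n)·((n(n+α_n)+(n+β_n)(n+α_n+β_n))/(2n+α_n+β_n)² − ε_n) → a_2/2; (1/δ_n²)·(n+β_n)(n+α_n)n/(2n+α_n+β_n)³ → b_1/4; and (1/δ_n²)·(n+β_n)(n+α_n)(n+α_n+β_n)n/(2n+α_n+β_n)⁴ → b_2/4 as n → ∞. Define f^{(a_1,a_2,b_1,b_2)}(x) = (b_1/(2π))·√(4b_2−(x−a_2)²) / ((b_2−b_1)x² + (b_1a_2+b_1a_1−2b_2a_1)x + b_2a_1² − a_1a_2b_1 + b_1²) for |x−a_2| ≤ 2√(b_2) and f^{(a_1,a_2,b_1,b_2)}(x) = 0 otherwise. Then for every ξ ∈ ℝ, lim_{n→∞} (1/n)·N^{(α_n,β_n)}(δ_n ξ + 2ε_n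 − 1) = ∫_{a_2−2√(b_2)}^{ξ} f^{(a_1,a_2,b_1,b_2)}(x) dx. -/
open Filter Topology

/-- Generalized binomial coefficient C(t, m) = t(t-1)⋯(t-m+1)/m! for real t. -/
noncomputable def genBinom (t : ℝ) (m : ℕ) : ℝ :=
  (∏ i ∈ Finset.range m, (t - (i : ℝ))) / (Nat.factorial m)

/-- Jacobi polynomial P_n^{(α,β)}. -/
noncomputable def jacobiP (n : ℕ) (α β : ℝ) (x : ℝ) : ℝ :=
  ∑ k ∈ Finset.range (n + 1),
    genBinom ((n : ℝ) + α) (n - k) * genBinom ((n : ℝ) + β) k *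
      ((x - 1) / 2) ^ k * ((x + 1) / 2) ^ (n - k)

/-- Number of zeros of P_n^{(α,β)} that are ≤ ξ. -/
noncomputable def jacobiN (n : ℕ) (α β ξ : ℝ) : ℕ :=
  {x : ℝ | jacobiP n α β x = 0 ∧ x ≤ ξ}.ncard

theorem eventually_count_ge_integral_of_interior {Z : ℕ → Set ℝ} (hfin : ∀ n, (Z n).Finite)
    {f : ℝ → ℝ} {A B : ℝ} (hcont : ContinuousOn f (Set.Ioo A B))
    (hloc : ∀ c d μ : ℝ, A < c → c < d → d < B → (∀ x ∈ Set.Icc c d, μ < f x) →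
      ∀ᶠ n : ℕ in atTop, (n : ℝ) * (d - c) * μ - 1 ≤ ((Z n ∩ Set.Ioc c d).ncard : ℝ))
    {c d η : ℝ} (hc : A < c) (hcd : c < d) (hd : d < B) (hη : 0 < η) :
    ∀ᶠ n : ℕ in atTop,
      (n : ℝ) * ((∫ x in c..d, f x) - η) ≤ ((Z n ∩ Set.Ioc c d).ncard : ℝ) := by
  have hsub : Set.Icc c d ⊆ Set.Ioo A B := fun x hx => ⟨hc.trans_le hx.1, hx.2.trans_lt hd⟩
  have hf : ContinuousOn f (Set.Icc c d) := hcont.mono hsub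
  have hL : 0 < d - c := sub_pos.2 hcd
  set η' : ℝ := η / (2 * (d - c)) with hη'
  have hη'0 : 0 < η' := by positivity
  obtain ⟨τ, hτ, hτf⟩ := Metric.uniformContinuousOn_iff.1
    (isCompact_Icc.uniformContinuousOn_of_continuous hf) η' hη'0
  obtain ⟨K, hK⟩ := exists_nat_gt ((d - c) / τ)
  have hK0 : (0 : ℝ) < K := lt_trans (by positivity) hK
  set h : ℝ := (d - c) / K with hh
  have hh0 : 0 < h := by positivity
  have hhτ : h < τ := by
    rw [hh, div_lt_iff₀ hK0]
    rw [div_lt_iff₀ hτ] at hK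
    linarith
  have hKh : c + K * h = d := by rw [hh]; field_simp; ring
  have hle : ∀ k : ℕ, k ≤ K → c + k * h ≤ d := by
    intro k hk
    have : (k : ℝ) ≤ K := by exact_mod_cast hk
    rw [← hKh]; gcongr
  have hge : ∀ k : ℕ, c ≤ c + k * h := fun k => by
    have : 0 ≤ (k : ℝ) * h := by positivity
    linarith
  have hii : ∀ x y, x ∈ Set.Icc c d → y ∈ Set.Icc c d →
      IntervalIntegrable f MeasureTheory.volume x y := fun x y hx hy =>
    (hf.mono (Set.uIcc_subset_Icc hx hy)).intervalIntegrable
  have key : ∀ k : ℕ, k ≤ K → ∀ᶠ n : ℕ in atTop,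
      (n : ℝ) * ((∫ x in c..(c + k * h), f x) - η' * (k * h)) - k ≤
        ((Z n ∩ Set.Ioc c (c + k * h)).ncard : ℝ) := by
    intro k
    induction k with
    | zero => intro _; exact Eventually.of_forall fun n => by simp
    | succ k ih =>
      intro hk
      have hx0 : c + k * h ∈ Set.Icc c d := ⟨hge k, hle k (by omega)⟩
      have hx1 : c + (k + 1 : ℕ) * h ∈ Set.Icc c d := ⟨hge _, hle _ hk⟩
      set x0 := c + k * h with hx0d
      set x1 := c + (k + 1 : ℕ) * h with hx1d
      have hx01 : x1 - x0 = h := by rw [hx0d, hx1d]; push_cast; ring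
      have hlt : x0 < x1 := by linarith
      have hosc : ∀ x ∈ Set.Icc x0 x1, (∫ y in x0..x1, f y) / h - η' < f x := by
        intro x hx
        have hxm : x ∈ Set.Icc c d := ⟨hx0.1.trans hx.1, hx.2.trans hx1.2⟩
        obtain ⟨z, hz, hzi⟩ := exists_eq_interval_average hlt.ne
          (f := f) (hf.mono (Set.uIcc_subset_Icc hx0 hx1))
        rw [Set.uIoo_of_lt hlt] at hz
        have hzm : z ∈ Set.Icc c d := ⟨hx0.1.trans hz.1.le, hz.2.le.trans hx1.2⟩
        rw [interval_average_eq_div, hx01] at hzi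
        rw [← hzi]
        have hd : dist z x < τ := by
          rw [Real.dist_eq, abs_lt]
          constructor <;> linarith [hx.1, hx.2, hz.1, hz.2]
        have := hτf z hzm x hxm hd
        rw [Real.dist_eq, abs_lt] at this
        linarith [this.2]
      filter_upwards [ih (by omega), hloc x0 x1 _ (hc.trans_le hx0.1) hlt (hx1.2.trans_lt hd) hosc]
        with n hn1 hn2
      have hun : Z n ∩ Set.Ioc c x1 = (Z n ∩ Set.Ioc c x0) ∪ (Z n ∩ Set.Ioc x0 x1) := by
        rw [← Set.inter_union_distrib_left, Set.Ioc_union_Ioc_eq_Ioc hx0.1 hlt.le]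
      have hdis : Disjoint (Z n ∩ Set.Ioc c x0) (Z n ∩ Set.Ioc x0 x1) :=
        (Set.Ioc_disjoint_Ioc_of_le le_rfl).mono Set.inter_subset_right Set.inter_subset_right
      rw [hun, Set.ncard_union_eq hdis ((hfin n).inter_of_left _) ((hfin n).inter_of_left _),
        ← intervalIntegral.integral_add_adjacent_intervals
          (hii c x0 ⟨le_rfl, hcd.le⟩ hx0) (hii x0 x1 hx0 hx1)]
      rw [hx01] at hn2
      have e : (n : ℝ) * h * ((∫ y in x0..x1, f y) / h - η') =
          n * ((∫ y in x0..x1, f y) - η' * h) := by field_simp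
      rw [e] at hn2
      push_cast
      linarith
  have := key K le_rfl
  rw [hKh] at this
  obtain ⟨n0, hn0⟩ := exists_nat_gt (K / (η / 2))
  filter_upwards [this, eventually_ge_atTop n0] with n hn hnn
  have h1 : (n0 : ℝ) ≤ n := by exact_mod_cast hnn
  have h2 : (K : ℝ) < n * (η / 2) := by
    rw [div_lt_iff₀ (by positivity)] at hn0
    nlinarith
  have h3 : η' * (K * h) = η / 2 := by
    rw [hη', hh]; field_simp
  rw [h3] at hn
  linarith

theorem eventually_count_ge_integral {Z : ℕ → Set ℝ} (hfin : ∀ n, (Z n).Finite)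
    {f : ℝ → ℝ} {A B : ℝ} (hcont : ContinuousOn f (Set.Ioo A B))
    (hint : IntervalIntegrable f MeasureTheory.volume A B)
    (hloc : ∀ c d μ : ℝ, A < c → c < d → d < B → (∀ x ∈ Set.Icc c d, μ < f x) →
      ∀ᶠ n : ℕ in atTop, (n : ℝ) * (d - c) * μ - 1 ≤ ((Z n ∩ Set.Ioc c d).ncard : ℝ))
    {c d η : ℝ} (hc : A ≤ c) (hcd : c ≤ d) (hd : d ≤ B) (hη : 0 < η) :
    ∀ᶠ n : ℕ in atTop,
      (n : ℝ) * ((∫ x in c..d, f x) - η) ≤ ((Z n ∩ Set.Ioc c d).ncard : ℝ) := by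
  rcases hcd.eq_or_lt with rfl | hlt
  · refine Eventually.of_forall fun n => ?_
    simp only [intervalIntegral.integral_same, Set.Ioc_self, Set.inter_empty, Set.ncard_empty]
    have : 0 ≤ (n : ℝ) * η := by positivity
    push_cast
    linarith
  have hsub : ∀ x y, x ∈ Set.Icc A B → y ∈ Set.Icc A B →
      IntervalIntegrable f MeasureTheory.volume x y := fun x y hx hy =>
    hint.mono_set (by rw [Set.uIcc_of_le (hc.trans (hcd.trans hd))]; exact Set.uIcc_subset_Icc hx hy)
  have hcI : c ∈ Set.Icc A B := ⟨hc, hcd.trans hd⟩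
  have hdI : d ∈ Set.Icc A B := ⟨hc.trans hcd, hd⟩
  have hΦ : ContinuousOn (fun x => ∫ t in c..x, f t) (Set.Icc c d) :=
    intervalIntegral.continuousOn_primitive_interval'
      (by simpa [Set.uIcc_of_le hcd] using hsub c d hcI hdI) (by simp) |>.mono
      (by rw [Set.uIcc_of_le hcd])
  have hη3 : 0 < η / 3 := by positivity
  have hcl : ∀ᶠ x in 𝓝[Set.Icc c d] c, |∫ t in c..x, f t| < η / 3 := by
    have := (Metric.tendsto_nhds.1 (hΦ c ⟨le_rfl, hcd⟩)) _ hη3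
    simpa [Real.dist_eq] using this
  have hdl : ∀ᶠ x in 𝓝[Set.Icc c d] d, |(∫ t in c..x, f t) - ∫ t in c..d, f t| < η / 3 := by
    have := (Metric.tendsto_nhds.1 (hΦ d ⟨hcd, le_rfl⟩)) _ hη3
    simpa [Real.dist_eq] using this
  have hmid : c < (c + d) / 2 ∧ (c + d) / 2 < d := ⟨by linarith, by linarith⟩
  obtain ⟨c', hc'1, hc'2⟩ : ∃ c' ∈ Set.Ioo c ((c + d) / 2), |∫ t in c..c', f t| < η / 3 := by
    have h1 : 𝓝[>] c ≤ 𝓝[Set.Icc c d] c := by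
      rw [← nhdsWithin_Ioo_eq_nhdsGT hlt]
      exact nhdsWithin_mono _ Set.Ioo_subset_Icc_self
    obtain ⟨x, hx⟩ := ((hcl.filter_mono h1).and (Ioo_mem_nhdsGT hmid.1)).exists
    exact ⟨x, hx.2, hx.1⟩
  obtain ⟨d', hd'1, hd'2⟩ : ∃ d' ∈ Set.Ioo ((c + d) / 2) d,
      |(∫ t in c..d', f t) - ∫ t in c..d, f t| < η / 3 := by
    have h1 : 𝓝[<] d ≤ 𝓝[Set.Icc c d] d := by
      rw [← nhdsWithin_Ioo_eq_nhdsLT hlt]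
      exact nhdsWithin_mono _ Set.Ioo_subset_Icc_self
    obtain ⟨x, hx⟩ := ((hdl.filter_mono h1).and (Ioo_mem_nhdsLT hmid.2)).exists
    exact ⟨x, hx.2, hx.1⟩
  have hlt' : c' < d' := hc'1.2.trans hd'1.1
  filter_upwards [eventually_count_ge_integral_of_interior hfin hcont hloc
    (hc.trans_lt hc'1.1) hlt' (hd'1.2.trans_le hd) hη3] with n hn
  have hc'I : c' ∈ Set.Icc A B := ⟨by linarith [hc'1.1], by linarith [hd'1.2]⟩
  have hd'I : d' ∈ Set.Icc A B := ⟨by linarith [hc'1.1], by linarith [hd'1.2]⟩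
  have hadd := intervalIntegral.integral_add_adjacent_intervals
    (hsub c c' hcI hc'I) (hsub c' d' hc'I hd'I)
  have hmono : ((Z n ∩ Set.Ioc c' d').ncard : ℝ) ≤ ((Z n ∩ Set.Ioc c d).ncard : ℝ) := by
    exact_mod_cast Set.ncard_le_ncard
      (Set.inter_subset_inter_right _ (Set.Ioc_subset_Ioc hc'1.1.le hd'1.2.le))
      ((hfin n).inter_of_left _)
  refine le_trans (le_trans ?_ hn) hmono
  have := abs_lt.1 hc'2
  have := abs_lt.1 hd'2
  gcongr ?_ * ?_
  linarith

theorem tendsto_count_of_local_lower_bound {Z : ℕ → Set ℝ} (hfin : ∀ n, (Z n).Finite)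
    (hcard : ∀ n, (Z n).ncard ≤ n) {f : ℝ → ℝ} {A B : ℝ} (hAB : A ≤ B)
    (hcont : ContinuousOn f (Set.Ioo A B))
    (hint : IntervalIntegrable f MeasureTheory.volume A B) (hone : ∫ x in A..B, f x = 1)
    (hzero : ∀ x, x ∉ Set.Icc A B → f x = 0)
    (hloc : ∀ c d μ : ℝ, A < c → c < d → d < B → (∀ x ∈ Set.Icc c d, μ < f x) →
      ∀ᶠ n : ℕ in atTop, (n : ℝ) * (d - c) * μ - 1 ≤ ((Z n ∩ Set.Ioc c d).ncard : ℝ))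
    (ξ : ℝ) :
    Tendsto (fun n : ℕ => ((Z n ∩ Set.Iic ξ).ncard : ℝ) / n) atTop (𝓝 (∫ x in A..ξ, f x)) := by
  set ξ' : ℝ := max A (min ξ B) with hξ'
  have hA' : A ≤ ξ' := le_max_left _ _
  have hB' : ξ' ≤ B := max_le hAB (min_le_right _ _)
  have hsub : ∀ x y, x ∈ Set.Icc A B → y ∈ Set.Icc A B →
      IntervalIntegrable f MeasureTheory.volume x y := fun x y hx hy =>
    hint.mono_set (by rw [Set.uIcc_of_le hAB]; exact Set.uIcc_subset_Icc hx hy)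
  have hadd := intervalIntegral.integral_add_adjacent_intervals
    (hsub A ξ' ⟨le_rfl, hAB⟩ ⟨hA', hB'⟩) (hsub ξ' B ⟨hA', hB'⟩ ⟨hAB, le_rfl⟩)
  rw [hone] at hadd
  have hξeq : ∫ x in A..ξ, f x = ∫ x in A..ξ', f x := by
    rcases lt_or_ge ξ A with h | h
    · have e : ξ' = A := by rw [hξ', max_eq_left ((min_le_left _ _).trans h.le)]
      rw [e, intervalIntegral.integral_same, intervalIntegral.integral_symm,
        intervalIntegral.integral_of_le h.le,
        MeasureTheory.integral_Ioc_eq_integral_Ioo,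
        MeasureTheory.setIntegral_eq_zero_of_forall_eq_zero, neg_zero]
      intro x hx
      exact hzero x fun hx' => absurd hx.2 (not_lt.2 hx'.1)
    rcases le_or_gt ξ B with h2 | h2
    · have e : ξ' = ξ := by rw [hξ', min_eq_left h2, max_eq_right h]
      rw [e]
    · have e : ξ' = B := by rw [hξ', min_eq_right h2.le, max_eq_right hAB]
      have hz : ∀ x ∈ Set.Ioc B ξ, f x = 0 := fun x hx =>
        hzero x fun hx' => absurd hx.1 (not_lt.2 hx'.2)
      have hi : IntervalIntegrable f MeasureTheory.volume B ξ := by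
        rw [intervalIntegrable_iff_integrableOn_Ioc_of_le h2.le]
        exact MeasureTheory.integrableOn_zero.congr_fun (fun x hx => (hz x hx).symm)
          measurableSet_Ioc
      rw [e, ← intervalIntegral.integral_add_adjacent_intervals hint hi,
        intervalIntegral.integral_of_le h2.le,
        MeasureTheory.setIntegral_eq_zero_of_forall_eq_zero hz, add_zero]
  rw [hξeq, Metric.tendsto_nhds]
  intro η hη
  have hη2 : 0 < η / 2 := by positivity
  filter_upwards [eventually_count_ge_integral hfin hcont hint hloc le_rfl hA' hB' hη2,
    eventually_count_ge_integral hfin hcont hint hloc hA' hB' le_rfl hη2,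
    eventually_gt_atTop 0] with n hn1 hn2 hn0
  have hn : (0 : ℝ) < n := by exact_mod_cast hn0
  have hl : ((Z n ∩ Set.Ioc A ξ').ncard : ℝ) ≤ ((Z n ∩ Set.Iic ξ).ncard : ℝ) := by
    have : Z n ∩ Set.Ioc A ξ' ⊆ Z n ∩ Set.Iic ξ := by
      rintro x ⟨hx, hx1, hx2⟩
      refine ⟨hx, ?_⟩
      rcases le_max_iff.1 hx2 with h | h
      · exact absurd hx1 (not_lt.2 h)
      · exact h.trans (min_le_left _ _)
    exact_mod_cast Set.ncard_le_ncard this ((hfin n).inter_of_left _)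
  have hu : ((Z n ∩ Set.Iic ξ).ncard : ℝ) + ((Z n ∩ Set.Ioc ξ' B).ncard : ℝ) ≤ n := by
    have hdis : Disjoint (Z n ∩ Set.Iic ξ) (Z n ∩ Set.Ioc ξ' B) := by
      rw [Set.disjoint_left]
      rintro x ⟨_, hx⟩ ⟨_, hx1, hx2⟩
      have h1 : min ξ B < x := (le_max_right _ _).trans_lt hx1
      rcases min_lt_iff.1 h1 with h | h
      · exact absurd hx (not_le.2 h)
      · exact absurd hx2 (not_le.2 h)
    have h1 := Set.ncard_union_eq hdis ((hfin n).inter_of_left _) ((hfin n).inter_of_left _)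
    have h2 : ((Z n ∩ Set.Iic ξ) ∪ (Z n ∩ Set.Ioc ξ' B)).ncard ≤ (Z n).ncard :=
      Set.ncard_le_ncard (Set.union_subset Set.inter_subset_left Set.inter_subset_left) (hfin n)
    exact_mod_cast (h1 ▸ h2).trans (hcard n)
  rw [Real.dist_eq, abs_lt]
  constructor
  · have : (∫ x in A..ξ', f x) - η / 2 ≤ ((Z n ∩ Set.Iic ξ).ncard : ℝ) / n := by
      rw [le_div_iff₀ hn]; linarith
    linarith
  · have : ((Z n ∩ Set.Iic ξ).ncard : ℝ) / n ≤ (∫ x in A..ξ', f x) + η / 2 := by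
      rw [div_le_iff₀ hn]
      have e : ∫ x in ξ'..B, f x = 1 - ∫ x in A..ξ', f x := by linarith
      rw [e] at hn2
      linarith
    linarith

theorem integral_sin_sq_div_two_pi {ρ σ : ℝ} (hρ : |ρ| < 1) (hσ : |σ| < 1) :
    ∫ θ in (0 : ℝ)..(2 * Real.pi), Real.sin θ ^ 2 /
      ((1 - 2 * ρ * Real.cos θ + ρ ^ 2) * (1 - 2 * σ * Real.cos θ + σ ^ 2)) =
      Real.pi / (1 - ρ * σ) := by
  have hne : ∀ t : ℝ, |t| < 1 → ∀ z : ℂ, ‖z‖ ≤ 1 → 1 - (t : ℂ) * z ≠ 0 := by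
    intro t ht z hz h
    have h1 : ‖(t : ℂ) * z‖ = 1 := by rw [← sub_eq_zero.1 h]; simp
    rw [norm_mul, Complex.norm_real, Real.norm_eq_abs] at h1
    nlinarith [abs_nonneg t, norm_nonneg z]
  set F : ℂ → ℂ := fun z => (1 - z ^ 2) / (2 * (1 - ρ * z) * (1 - σ * z)) with hF
  have hd : DifferentiableOn ℂ F (Metric.closedBall 0 1) := by
    intro z hz
    have hz' : ‖z‖ ≤ 1 := by simpa using hz
    have h1 := hne ρ hρ z hz'
    have h2 := hne σ hσ z hz'
    apply DifferentiableAt.differentiableWithinAt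
    apply DifferentiableAt.div (by fun_prop) (by fun_prop)
    exact mul_ne_zero (mul_ne_zero two_ne_zero h1) h2
  have hσb : (σ : ℂ) ∈ Metric.ball (0 : ℂ) 1 := by simpa using hσ
  have hC := hd.circleIntegral_sub_inv_smul hσb
  have hz : ∀ θ : ℝ, ‖circleMap 0 1 θ‖ = 1 := fun θ => by simp
  have hzσ : ∀ θ : ℝ, circleMap 0 1 θ - (σ : ℂ) ≠ 0 := fun θ h => by
    have := hz θ
    rw [sub_eq_zero.1 h, Complex.norm_real, Real.norm_eq_abs] at this
    linarith
  set Ψ : ℝ → ℂ := fun θ => circleMap 0 1 θ * (circleMap 0 1 θ - σ)⁻¹ * F (circleMap 0 1 θ) with hΨ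
  have hΨc : Continuous Ψ := by
    have hc := continuous_circleMap (0 : ℂ) 1
    have h1 : Continuous fun θ => F (circleMap 0 1 θ) :=
      hd.continuousOn.comp_continuous hc fun θ => by simp
    exact (hc.mul ((hc.sub continuous_const).inv₀ hzσ)).mul h1
  have hint : ∫ θ in (0 : ℝ)..(2 * Real.pi), Ψ θ = Real.pi / (1 - ρ * σ) := by
    have h1 : (∮ z in C(0, 1), (z - (σ : ℂ))⁻¹ • F z) =
        Complex.I * ∫ θ in (0 : ℝ)..(2 * Real.pi), Ψ θ := by
      rw [circleIntegral, ← intervalIntegral.integral_const_mul]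
      congr 1
      ext θ
      simp only [deriv_circleMap, smul_eq_mul, hΨ]
      ring
    rw [h1] at hC
    have h2 := hne ρ hρ σ (by simpa using hσ.le)
    have h3 := hne σ hσ σ (by simpa using hσ.le)
    have h4 : F σ = 1 / (2 * (1 - ρ * σ)) := by
      have h5 : 1 - (σ : ℂ) ^ 2 ≠ 0 := by rwa [sq]
      simp only [hF]
      rw [div_eq_div_iff (mul_ne_zero (mul_ne_zero two_ne_zero h2) h3) (mul_ne_zero two_ne_zero h2)]
      ring
    apply mul_left_cancel₀ Complex.I_ne_zero
    rw [hC, h4, smul_eq_mul]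
    field_simp
  have hre : ∀ θ, (Ψ θ).re = Real.sin θ ^ 2 /
      ((1 - 2 * ρ * Real.cos θ + ρ ^ 2) * (1 - 2 * σ * Real.cos θ + σ ^ 2)) := by
    intro θ
    have h1 := hne ρ hρ _ (hz θ).le
    have h2 := hne σ hσ _ (hz θ).le
    have h3 := hzσ θ
    have e : circleMap 0 1 θ = Real.cos θ + Real.sin θ * Complex.I := by
      rw [circleMap, Complex.exp_mul_I]; simp
    have hsc : (Complex.sin θ) ^ 2 + (Complex.cos θ) ^ 2 = 1 := Complex.sin_sq_add_cos_sq _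
    have hA : ∀ t : ℝ, |t| < 1 → (1 - 2 * t * Real.cos θ + t ^ 2) ≠ 0 := by
      intro t ht
      have := Real.sin_sq_add_cos_sq θ
      have h1 := abs_lt.1 ht
      have h2 : 1 - 2 * t * Real.cos θ + t ^ 2 = (t - Real.cos θ) ^ 2 + Real.sin θ ^ 2 := by
        nlinarith
      intro h
      rw [h2] at h
      have h3 : Real.sin θ = 0 := by nlinarith [sq_nonneg (t - Real.cos θ), sq_nonneg (Real.sin θ)]
      have h4 : t = Real.cos θ := by nlinarith [sq_nonneg (t - Real.cos θ), sq_nonneg (Real.sin θ)]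
      rw [h3, ← h4] at this
      nlinarith
    have hA1 := hA ρ hρ
    have hA2 := hA σ hσ
    have hΨe : Ψ θ = ((Real.sin θ ^ 2 / ((1 - 2 * ρ * Real.cos θ + ρ ^ 2) *
        (1 - 2 * σ * Real.cos θ + σ ^ 2)) : ℝ) : ℂ) +
        (((ρ - Real.cos θ) * Real.sin θ / ((1 - 2 * ρ * Real.cos θ + ρ ^ 2) *
        (1 - 2 * σ * Real.cos θ + σ ^ 2)) : ℝ) : ℂ) * Complex.I := by
      have hA1' : (1 - 2 * ρ * Complex.cos θ + ρ ^ 2) ≠ 0 := by exact_mod_cast hA1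
      have hA2' : (1 - 2 * σ * Complex.cos θ + σ ^ 2) ≠ 0 := by exact_mod_cast hA2
      have hprod : (circleMap 0 1 θ - σ) * (1 - σ * circleMap 0 1 θ) =
          circleMap 0 1 θ * (1 - 2 * σ * Complex.cos θ + σ ^ 2) := by
        rw [e]; push_cast
        linear_combination σ * hsc +
          (-σ * (Complex.sin θ) ^ 2) * Complex.I_sq
      have hprod2 : (1 - ρ * circleMap 0 1 θ) * (1 - ρ * (Complex.cos θ - Complex.sin θ * Complex.I))
          = 1 - 2 * ρ * Complex.cos θ + ρ ^ 2 := by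
        rw [e]; push_cast
        linear_combination (ρ ^ 2) * hsc - (ρ ^ 2 * (Complex.sin θ) ^ 2) * Complex.I_sq
      have hz0 : circleMap 0 1 θ ≠ 0 := fun h => by have := hz θ; rw [h] at this; simp at this
      have e1 : Ψ θ = (1 - circleMap 0 1 θ ^ 2) *
          (1 - ρ * (Complex.cos θ - Complex.sin θ * Complex.I)) /
          (2 * ((1 - 2 * ρ * Complex.cos θ + ρ ^ 2) * (1 - 2 * σ * Complex.cos θ + σ ^ 2))) := by
        have e2 : Ψ θ = circleMap 0 1 θ * (1 - circleMap 0 1 θ ^ 2) / (2 * (1 - ρ * circleMap 0 1 θ)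
            * ((circleMap 0 1 θ - σ) * (1 - σ * circleMap 0 1 θ))) := by
          simp only [hΨ, hF]
          field_simp
        rw [e2, hprod, div_eq_div_iff (mul_ne_zero (mul_ne_zero two_ne_zero h1)
          (mul_ne_zero hz0 hA2')) (mul_ne_zero two_ne_zero (mul_ne_zero hA1' hA2')), ← hprod2]
        ring
      have hnum : (1 - circleMap 0 1 θ ^ 2) *
          (1 - ρ * (Complex.cos θ - Complex.sin θ * Complex.I)) =
          2 * (Complex.sin θ ^ 2 + (ρ - Complex.cos θ) * Complex.sin θ * Complex.I) := by
        rw [e]; push_cast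
        linear_combination (-1 + ρ * (Complex.cos θ + Complex.sin θ * Complex.I)) * hsc +
          (-Complex.sin θ ^ 2 - ρ * (Complex.cos θ + Complex.sin θ * Complex.I) *
            Complex.sin θ ^ 2) * Complex.I_sq
      rw [e1, hnum, mul_div_mul_left _ _ two_ne_zero]
      push_cast
      ring
    rw [hΨe, Complex.add_re, Complex.ofReal_re, Complex.re_ofReal_mul, Complex.I_re, mul_zero,
      add_zero]
  have := Complex.reCLM.intervalIntegral_comp_comm 
    (hΨc.intervalIntegrable (μ := MeasureTheory.volume) 0 (2 * Real.pi))
  simp only [Complex.reCLM_apply, hre, hint] at this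
  rw [this]
  have e : (Real.pi : ℂ) / (1 - ρ * σ) = ((Real.pi / (1 - ρ * σ) : ℝ) : ℂ) := by push_cast; rfl
  rw [e, Complex.ofReal_re]

theorem sin_sq_le_one_sub_two_mul_cos_add_sq (ρ θ : ℝ) :
    Real.sin θ ^ 2 ≤ 1 - 2 * ρ * Real.cos θ + ρ ^ 2 := by
  nlinarith [Real.sin_sq_add_cos_sq θ, sq_nonneg (ρ - Real.cos θ)]

theorem sin_sq_le_mul_of_mul_nonpos {ρ σ : ℝ} (h : ρ * σ ≤ 0) (θ : ℝ) :
    Real.sin θ ^ 2 ≤ (1 - 2 * ρ * Real.cos θ + ρ ^ 2) * (1 - 2 * σ * Real.cos θ + σ ^ 2) := by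
  have h1 := sin_sq_le_one_sub_two_mul_cos_add_sq ρ θ
  have h2 := sin_sq_le_one_sub_two_mul_cos_add_sq σ θ
  have h0 := sq_nonneg (Real.sin θ)
  rcases le_or_gt (ρ * Real.cos θ) 0 with hr | hr
  · nlinarith [sq_nonneg ρ]
  · have hs : σ * Real.cos θ ≤ 0 := by
      by_contra! hs
      nlinarith [mul_pos hr hs, sq_nonneg (Real.cos θ)]
    nlinarith [sq_nonneg σ]

theorem integral_sin_sq_div_pi {ρ σ : ℝ} (hρ : |ρ| < 1) (hσ : |σ| < 1) :
    ∫ θ in (0 : ℝ)..Real.pi, Real.sin θ ^ 2 /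
      ((1 - 2 * ρ * Real.cos θ + ρ ^ 2) * (1 - 2 * σ * Real.cos θ + σ ^ 2)) =
      Real.pi / (2 * (1 - ρ * σ)) := by
  have h := integral_sin_sq_div_two_pi hρ hσ
  set g : ℝ → ℝ := fun θ => Real.sin θ ^ 2 /
      ((1 - 2 * ρ * Real.cos θ + ρ ^ 2) * (1 - 2 * σ * Real.cos θ + σ ^ 2)) with hg
  have hpos : ∀ t : ℝ, |t| < 1 → ∀ θ : ℝ, 1 - 2 * t * Real.cos θ + t ^ 2 ≠ 0 := by
    intro t ht θ
    have h1 : |t| * |Real.cos θ| ≤ |t| :=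
      mul_le_of_le_one_right (abs_nonneg t) (Real.abs_cos_le_one θ)
    rw [← abs_mul] at h1
    have h2 := le_abs_self (t * Real.cos θ)
    have h3 := sq_abs t
    nlinarith
  have hc : Continuous g := by
    refine Continuous.div (by fun_prop) (by fun_prop) fun θ => ?_
    exact mul_ne_zero (hpos ρ hρ θ) (hpos σ hσ θ)
  have h2 : ∫ θ in Real.pi..(2 * Real.pi), g θ = ∫ θ in (0 : ℝ)..Real.pi, g θ := by
    have h3 := intervalIntegral.integral_comp_sub_left (a := 0) (b := Real.pi) g (2 * Real.pi)
    have h4 : ∀ θ, g (2 * Real.pi - θ) = g θ := fun θ => by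
      simp only [hg, Real.cos_two_pi_sub, Real.sin_two_pi_sub, neg_sq]
    simp only [h4, sub_zero] at h3
    rw [h3]; congr 1; ring
  rw [← intervalIntegral.integral_add_adjacent_intervals
    (hc.intervalIntegrable 0 Real.pi) (hc.intervalIntegrable _ _), h2] at h
  rw [mul_comm, ← div_div, ← h]
  ring

theorem integral_sin_sq_div_pi_of_le_one {ρ σ : ℝ} (hρ : |ρ| ≤ 1) (hσ : |σ| ≤ 1)
    (hρσ : ρ * σ ≤ 0) :
    ∫ θ in (0 : ℝ)..Real.pi, Real.sin θ ^ 2 /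
      ((1 - 2 * ρ * Real.cos θ + ρ ^ 2) * (1 - 2 * σ * Real.cos θ + σ ^ 2)) =
      Real.pi / (2 * (1 - ρ * σ)) := by
  have hIoo : ∀ᶠ t : ℝ in 𝓝[<] 1, t ∈ Set.Ioo (0 : ℝ) 1 := Ioo_mem_nhdsLT one_pos
  have hnl : Tendsto (fun t : ℝ => t) (𝓝[<] 1) (𝓝 1) := tendsto_nhdsWithin_of_tendsto_nhds tendsto_id
  have h1 : Tendsto (fun t : ℝ => ∫ θ in (0 : ℝ)..Real.pi, Real.sin θ ^ 2 /
      ((1 - 2 * (t * ρ) * Real.cos θ + (t * ρ) ^ 2) *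
        (1 - 2 * (t * σ) * Real.cos θ + (t * σ) ^ 2))) (𝓝[<] 1)
      (𝓝 (∫ θ in (0 : ℝ)..Real.pi, Real.sin θ ^ 2 /
      ((1 - 2 * ρ * Real.cos θ + ρ ^ 2) * (1 - 2 * σ * Real.cos θ + σ ^ 2)))) := by
    apply intervalIntegral.tendsto_integral_filter_of_dominated_convergence (fun _ => (1 : ℝ))
    · exact Eventually.of_forall fun t => (by fun_prop : Measurable _).aestronglyMeasurable
    · filter_upwards [hIoo] with t ht
      refine Eventually.of_forall fun θ _ => ?_
      have hts : t * ρ * (t * σ) ≤ 0 := by nlinarith [mul_pos ht.1 ht.1]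
      have hle := sin_sq_le_mul_of_mul_nonpos hts θ
      rw [Real.norm_eq_abs, abs_of_nonneg (div_nonneg (sq_nonneg _) ((sq_nonneg _).trans hle))]
      exact div_le_one_of_le₀ hle ((sq_nonneg _).trans hle)
    · simp
    · have hne : ∀ᵐ θ : ℝ ∂MeasureTheory.volume, θ ≠ Real.pi :=
        MeasureTheory.Measure.ae_ne _ _
      filter_upwards [hne] with θ hθ hθI
      rw [Set.uIoc_of_le Real.pi_pos.le] at hθI
      have hs : 0 < Real.sin θ := Real.sin_pos_of_pos_of_lt_pi hθI.1 (lt_of_le_of_ne hθI.2 hθ)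
      have hle := sin_sq_le_mul_of_mul_nonpos hρσ θ
      have hD := (lt_of_lt_of_le (pow_pos hs 2) hle).ne'
      have hca : ContinuousAt (fun t : ℝ => Real.sin θ ^ 2 /
        ((1 - 2 * (t * ρ) * Real.cos θ + (t * ρ) ^ 2) *
        (1 - 2 * (t * σ) * Real.cos θ + (t * σ) ^ 2))) 1 := by
        apply ContinuousAt.div (by fun_prop) (by fun_prop)
        simpa using hD
      have := hca.tendsto.comp hnl
      simpa [Function.comp_def] using this
  have h2 : Tendsto (fun t : ℝ => Real.pi / (2 * (1 - (t * ρ) * (t * σ)))) (𝓝[<] 1)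
      (𝓝 (Real.pi / (2 * (1 - ρ * σ)))) := by
    have hca : ContinuousAt (fun t : ℝ => Real.pi / (2 * (1 - (t * ρ) * (t * σ)))) 1 := by
      apply ContinuousAt.div (by fun_prop) (by fun_prop)
      nlinarith
    have := hca.tendsto.comp hnl
    simpa [Function.comp_def] using this
  refine tendsto_nhds_unique (h1.congr' ?_) h2
  filter_upwards [hIoo] with t ht
  have hlt : ∀ r : ℝ, |r| ≤ 1 → |t * r| < 1 := fun r hr => by
    rw [abs_mul, abs_of_pos ht.1]
    nlinarith [ht.1, ht.2, abs_nonneg r]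
  exact integral_sin_sq_div_pi (hlt ρ hρ) (hlt σ hσ)

/-- The denominator of the density, as a quadratic polynomial in `x`. -/
def densityDenom (a1 a2 b1 b2 x : ℝ) : ℝ :=
  (b2 - b1) * x ^ 2 + (b1 * a2 + b1 * a1 - 2 * b2 * a1) * x +
    b2 * a1 ^ 2 - a1 * a2 * b1 + b1 ^ 2

theorem exists_densityDenom_factorization {a1 a2 b1 b2 : ℝ} (hb2 : 0 < b2)
    (h12 : b2 ≤ b1) (h21 : b1 ≤ 2 * b2) (hd : b2 * (a2 - a1) ^ 2 ≤ (2 * b2 - b1) ^ 2) :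
    ∃ ρ σ : ℝ, |ρ| ≤ 1 ∧ |σ| ≤ 1 ∧ ρ * σ ≤ 0 ∧ b1 = b2 * (1 - ρ * σ) ∧
      ∀ c : ℝ, densityDenom a1 a2 b1 b2 (a2 + 2 * Real.sqrt b2 * c) =
        b2 ^ 2 * ((1 - 2 * ρ * c + ρ ^ 2) * (1 - 2 * σ * c + σ ^ 2)) := by
  obtain ⟨s, hs⟩ : ∃ s, s = Real.sqrt b2 := ⟨_, rfl⟩
  have hs0 : 0 < s := hs ▸ Real.sqrt_pos.2 hb2
  have hs2 : b2 = s ^ 2 := by rw [hs, Real.sq_sqrt hb2.le]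
  rw [← hs]
  obtain ⟨τ, hτ⟩ : ∃ τ, a1 = a2 + s * τ := ⟨(a1 - a2) / s, by field_simp; ring⟩
  obtain ⟨κ, hκ⟩ : ∃ κ, b1 = b2 * (1 + κ) := ⟨b1 / b2 - 1, by field_simp; ring⟩
  have hκ0 : 0 ≤ κ := by
    rw [hκ] at h12; nlinarith
  have hκ1 : κ ≤ 1 := by
    rw [hκ] at h21; nlinarith
  have hτκ : τ ^ 2 ≤ (1 - κ) ^ 2 := by
    have e1 : b2 * (a2 - a1) ^ 2 = b2 ^ 2 * τ ^ 2 := by rw [hτ, hs2]; ring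
    have e2 : (2 * b2 - b1) ^ 2 = b2 ^ 2 * (1 - κ) ^ 2 := by rw [hκ]; ring
    rw [e1, e2] at hd
    exact le_of_mul_le_mul_left hd (by positivity)
  have hτ1 : |τ| ≤ 1 - κ := by
    have := sq_le_sq.1 hτκ
    rwa [abs_of_nonneg (by linarith : 0 ≤ 1 - κ)] at this
  obtain ⟨ω, hω⟩ : ∃ ω, ω = Real.sqrt (τ ^ 2 + 4 * κ) := ⟨_, rfl⟩
  have hω0 : 0 ≤ ω := hω ▸ Real.sqrt_nonneg _
  have hω2 : ω ^ 2 = τ ^ 2 + 4 * κ := by rw [hω, Real.sq_sqrt (by positivity)]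
  have hωle : ω ≤ 2 - |τ| := by
    have : ω ^ 2 ≤ (2 - |τ|) ^ 2 := by rw [hω2]; nlinarith [sq_abs τ]
    exact (le_abs_self _).trans (abs_le_of_sq_le_sq this (by linarith))
  have hκω : κ = (ω ^ 2 - τ ^ 2) / 4 := by rw [hω2]; ring
  have h1 := le_abs_self τ
  have h2 := neg_abs_le τ
  refine ⟨(τ + ω) / 2, (τ - ω) / 2, ?_, ?_, ?_, ?_, ?_⟩
  · rw [abs_le]; constructor <;> linarith
  · rw [abs_le]; constructor <;> linarith
  · nlinarith
  · rw [hκ, hκω]; ring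
  · intro c
    rw [densityDenom, hκ, hκω, hs2, hτ]; ring

theorem density_integral {a1 a2 b1 b2 : ℝ} (hb2 : 0 < b2)
    (h12 : b2 ≤ b1) (h21 : b1 ≤ 2 * b2) (hd : b2 * (a2 - a1) ^ 2 ≤ (2 * b2 - b1) ^ 2)
    {f : ℝ → ℝ}
    (hf : ∀ x, |x - a2| ≤ 2 * Real.sqrt b2 → f x = (b1 / (2 * Real.pi)) *
      Real.sqrt (4 * b2 - (x - a2) ^ 2) / densityDenom a1 a2 b1 b2 x) :
    IntervalIntegrable f MeasureTheory.volume (a2 - 2 * Real.sqrt b2) (a2 + 2 * Real.sqrt b2) ∧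
      ∫ x in (a2 - 2 * Real.sqrt b2)..(a2 + 2 * Real.sqrt b2), f x = 1 := by
  obtain ⟨ρ, σ, hρ, hσ, hρσ, hb1, hD⟩ := exists_densityDenom_factorization hb2 h12 h21 hd
  obtain ⟨s, hs⟩ : ∃ s, s = Real.sqrt b2 := ⟨_, rfl⟩
  have hs0 : 0 < s := hs ▸ Real.sqrt_pos.2 hb2
  have hs2 : b2 = s ^ 2 := by rw [hs, Real.sq_sqrt hb2.le]
  rw [← hs] at hD hf ⊢
  have hπ := Real.pi_pos
  set φ : ℝ → ℝ := fun θ => a2 + 2 * s * Real.cos θ with hφ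
  set g : ℝ → ℝ := fun θ => Real.sin θ ^ 2 /
      ((1 - 2 * ρ * Real.cos θ + ρ ^ 2) * (1 - 2 * σ * Real.cos θ + σ ^ 2)) with hg
  have hderiv : ∀ θ ∈ Set.Ioo 0 Real.pi,
      HasDerivWithinAt φ (-(2 * s * Real.sin θ)) (Set.Ioo 0 Real.pi) θ := by
    intro θ _
    have := ((Real.hasDerivAt_cos θ).const_mul (2 * s)).const_add a2
    exact (this.congr_deriv (by ring)).hasDerivWithinAt
  have hinj : Set.InjOn φ (Set.Ioo 0 Real.pi) := by
    intro x hx y hy hxy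
    simp only [hφ] at hxy
    have : Real.cos x = Real.cos y := by
      have : 2 * s * Real.cos x = 2 * s * Real.cos y := by linarith
      exact mul_left_cancel₀ (by positivity) this
    exact Real.injOn_cos (Set.Ioo_subset_Icc_self hx) (Set.Ioo_subset_Icc_self hy) this
  have himg : φ '' Set.Ioo 0 Real.pi = Set.Ioo (a2 - 2 * s) (a2 + 2 * s) := by
    ext x
    constructor
    · rintro ⟨θ, hθ, rfl⟩
      have h1 : Real.cos θ < 1 := by
        rw [← Real.cos_zero]
        exact Real.cos_lt_cos_of_nonneg_of_le_pi le_rfl hθ.2.le hθ.1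
      have h2 : -1 < Real.cos θ := by
        rw [← Real.cos_pi]
        exact Real.cos_lt_cos_of_nonneg_of_le_pi hθ.1.le le_rfl hθ.2
      constructor <;> simp only [hφ] <;> nlinarith
    · intro hx
      have h1 : (x - a2) / (2 * s) < 1 := by rw [div_lt_one (by positivity)]; linarith [hx.2]
      have h2 : -1 < (x - a2) / (2 * s) := by rw [lt_div_iff₀ (by positivity)]; linarith [hx.1]
      refine ⟨Real.arccos ((x - a2) / (2 * s)), ⟨Real.arccos_pos.2 h1, ?_⟩, ?_⟩
      · refine lt_of_le_of_ne (Real.arccos_le_pi _) fun h => ?_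
        rw [Real.arccos_eq_pi] at h
        linarith
      · simp only [hφ]
        rw [Real.cos_arccos h2.le h1.le]
        field_simp
        ring
  have hcomp : ∀ θ ∈ Set.Ioo 0 Real.pi, |-(2 * s * Real.sin θ)| • f (φ θ) =
      (2 * (1 - ρ * σ) / Real.pi) * g θ := by
    intro θ hθ
    have hsin : 0 < Real.sin θ := Real.sin_pos_of_pos_of_lt_pi hθ.1 hθ.2
    have hle := sin_sq_le_mul_of_mul_nonpos hρσ θ
    have hpos := lt_of_lt_of_le (pow_pos hsin 2) hle
    have hx : |φ θ - a2| ≤ 2 * s := by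
      have e : φ θ - a2 = 2 * s * Real.cos θ := by simp only [hφ]; ring
      rw [e, abs_mul, abs_of_pos (by positivity : 0 < 2 * s)]
      exact mul_le_of_le_one_right (by positivity) (Real.abs_cos_le_one θ)
    have hsq : Real.sqrt (4 * b2 - (φ θ - a2) ^ 2) = 2 * s * Real.sin θ := by
      have e : 4 * b2 - (φ θ - a2) ^ 2 = (2 * s * Real.sin θ) ^ 2 := by
        simp only [hφ]
        rw [hs2, mul_pow, mul_pow, Real.sin_sq]; ring
      rw [e, Real.sqrt_sq (by positivity)]
    rw [hf _ hx, hsq, abs_neg, abs_of_pos (by positivity), smul_eq_mul]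
    simp only [hφ, hg]
    rw [hD, hb1, hs2]
    field_simp
  have hgint : MeasureTheory.IntegrableOn g (Set.Ioo 0 Real.pi) := by
    refine MeasureTheory.Measure.integrableOn_of_bounded (M := 1) (by simp)
      (by fun_prop : Measurable g).aestronglyMeasurable ?_
    refine Eventually.of_forall fun θ => ?_
    have hle := sin_sq_le_mul_of_mul_nonpos hρσ θ
    simp only [hg]
    rw [Real.norm_eq_abs, abs_of_nonneg (div_nonneg (sq_nonneg _) ((sq_nonneg _).trans hle))]
    exact div_le_one_of_le₀ hle ((sq_nonneg _).trans hle)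
  have hle : a2 - 2 * s ≤ a2 + 2 * s := by linarith
  constructor
  · rw [intervalIntegrable_iff_integrableOn_Ioo_of_le hle, ← himg,
      MeasureTheory.integrableOn_image_iff_integrableOn_abs_deriv_smul measurableSet_Ioo hderiv
        hinj f]
    exact MeasureTheory.IntegrableOn.congr_fun (hgint.const_mul _)
      (fun θ hθ => (hcomp θ hθ).symm) measurableSet_Ioo
  · rw [intervalIntegral.integral_of_le hle, MeasureTheory.integral_Ioc_eq_integral_Ioo, ← himg,
      MeasureTheory.integral_image_eq_integral_abs_deriv_smul measurableSet_Ioo hderiv hinj f,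
      MeasureTheory.setIntegral_congr_fun measurableSet_Ioo hcomp,
      MeasureTheory.integral_const_mul, ← MeasureTheory.integral_Ioc_eq_integral_Ioo,
      ← intervalIntegral.integral_of_le hπ.le, integral_sin_sq_div_pi_of_le_one hρ hσ hρσ]
    have : 1 - ρ * σ ≠ 0 := by nlinarith
    field_simp

theorem genBinom_succ_mul (t : ℝ) (m : ℕ) :
    genBinom t (m + 1) * ((m : ℝ) + 1) = genBinom t m * (t - m) := by
  have h1 : (Nat.factorial m : ℝ) ≠ 0 := by positivity
  have h2 : (m : ℝ) + 1 ≠ 0 := by positivity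
  rw [genBinom, genBinom, Finset.prod_range_succ, Nat.factorial_succ]
  push_cast
  field_simp

/-- First derivative of `jacobiP` away from `±1`, written with logarithmic derivatives. -/
noncomputable def jacobiDeriv (n : ℕ) (α β x : ℝ) : ℝ :=
  ∑ k ∈ Finset.range (n + 1),
    genBinom ((n : ℝ) + α) (n - k) * genBinom ((n : ℝ) + β) k *
      ((x - 1) / 2) ^ k * ((x + 1) / 2) ^ (n - k) *
      ((k / ((x - 1) / 2) + (n - k : ℕ) / ((x + 1) / 2)) / 2)

/-- Second derivative of `jacobiP` away from `±1`, written with logarithmic derivatives. -/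
noncomputable def jacobiDeriv₂ (n : ℕ) (α β x : ℝ) : ℝ :=
  ∑ k ∈ Finset.range (n + 1),
    genBinom ((n : ℝ) + α) (n - k) * genBinom ((n : ℝ) + β) k *
      ((x - 1) / 2) ^ k * ((x + 1) / 2) ^ (n - k) *
      (((k / ((x - 1) / 2) + (n - k : ℕ) / ((x + 1) / 2)) ^ 2 -
        (k / ((x - 1) / 2) ^ 2 + (n - k : ℕ) / ((x + 1) / 2) ^ 2)) / 4)

theorem hasDerivAt_half_pow (c : ℝ) (k : ℕ) {x : ℝ} (hx : (x + c) / 2 ≠ 0) :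
    HasDerivAt (fun x : ℝ => ((x + c) / 2) ^ k) (((x + c) / 2) ^ k * (k / ((x + c) / 2) / 2)) x := by
  have h := (((hasDerivAt_id x).add_const c).div_const 2).pow k
  refine h.congr_deriv ?_
  rcases k with _ | k
  · simp
  · have hx' : x + c ≠ 0 := fun h => hx (by rw [h, zero_div])
    simp only [id, Nat.add_sub_cancel, pow_succ]
    field_simp

theorem hasDerivAt_jacobi_monomial (k j : ℕ) {x : ℝ} (hX : (x - 1) / 2 ≠ 0)
    (hY : (x + 1) / 2 ≠ 0) (C : ℝ) :
    HasDerivAt (fun x : ℝ => C * ((x - 1) / 2) ^ k * ((x + 1) / 2) ^ j)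
      (C * ((x - 1) / 2) ^ k * ((x + 1) / 2) ^ j *
        ((k / ((x - 1) / 2) + j / ((x + 1) / 2)) / 2)) x := by
  have h1 := hasDerivAt_half_pow (-1) k (x := x) (by simpa [sub_eq_add_neg] using hX)
  simp only [← sub_eq_add_neg] at h1
  refine ((h1.const_mul C).mul (hasDerivAt_half_pow 1 j hY)).congr_deriv ?_
  ring

theorem hasDerivAt_jacobiP (n : ℕ) (α β : ℝ) {x : ℝ} (hX : (x - 1) / 2 ≠ 0)
    (hY : (x + 1) / 2 ≠ 0) :
    HasDerivAt (jacobiP n α β) (jacobiDeriv n α β x) x :=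
  HasDerivAt.fun_sum fun k _ => hasDerivAt_jacobi_monomial k (n - k) hX hY _

theorem hasDerivAt_jacobiDeriv (n : ℕ) (α β : ℝ) {x : ℝ} (hX : (x - 1) / 2 ≠ 0)
    (hY : (x + 1) / 2 ≠ 0) :
    HasDerivAt (jacobiDeriv n α β) (jacobiDeriv₂ n α β x) x := by
  refine HasDerivAt.fun_sum fun k _ => ?_
  have h1 := ((hasDerivAt_id x).sub_const 1).div_const 2
  have h2 := ((hasDerivAt_id x).add_const 1).div_const 2
  have h3 := (((hasDerivAt_const x (k : ℝ)).div h1 hX).add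
    ((hasDerivAt_const x ((n - k : ℕ) : ℝ)).div h2 hY)).div_const 2
  refine ((hasDerivAt_jacobi_monomial k (n - k) hX hY _).mul h3).congr_deriv ?_
  simp only [id, Pi.add_apply, Pi.div_apply]
  field_simp
  ring

theorem jacobiP_ode (n : ℕ) (α β : ℝ) {x : ℝ} (hX : (x - 1) / 2 ≠ 0) (hY : (x + 1) / 2 ≠ 0) :
    (1 - x ^ 2) * jacobiDeriv₂ n α β x + (β - α - (α + β + 2) * x) * jacobiDeriv n α β x +
      n * (n + α + β + 1) * jacobiP n α β x = 0 := by
  obtain ⟨X, hXe⟩ : ∃ X, X = (x - 1) / 2 := ⟨_, rfl⟩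
  have hYe : (x + 1) / 2 = X + 1 := by rw [hXe]; ring
  have hx : x = 2 * X + 1 := by rw [hXe]; ring
  rw [hYe] at hY
  rw [← hXe] at hX
  set c : ℕ → ℝ := fun k => genBinom ((n : ℝ) + α) (n - k) * genBinom ((n : ℝ) + β) k with hc
  set W : ℕ → ℝ := fun k => Nat.casesOn k 0 fun k =>
    c k * X ^ k * (X + 1) ^ (n - k) * ((n - k : ℕ) * ((n - k : ℕ) + β) * (X / (X + 1) - 1)) with hW
  have hterm : ∀ k ∈ Finset.range (n + 1),
      c k * X ^ k * (X + 1) ^ (n - k) *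
        ((1 - x ^ 2) * (((k / X + (n - k : ℕ) / (X + 1)) ^ 2 -
          (k / X ^ 2 + (n - k : ℕ) / (X + 1) ^ 2)) / 4) +
        (β - α - (α + β + 2) * x) * ((k / X + (n - k : ℕ) / (X + 1)) / 2) +
        n * (n + α + β + 1)) = W k - W (k + 1) := by
    intro k hk
    obtain ⟨j, rfl⟩ := Nat.exists_eq_add_of_le (Nat.lt_succ_iff.1 (Finset.mem_range.1 hk))
    have hWk : W k = c k * X ^ k * (X + 1) ^ j * (k * (k + α) * (1 - (X + 1) / X)) := by
      rcases k with _ | k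
      · simp [hW]
      · have e1 : k + 1 + j - k = j + 1 := by omega
        have e2 : k + 1 + j - (k + 1) = j := by omega
        simp only [hW, hc, e1, e2]
        have r1 := genBinom_succ_mul (((k + 1 + j : ℕ) : ℝ) + α) j
        have r2 := genBinom_succ_mul (((k + 1 + j : ℕ) : ℝ) + β) k
        push_cast at r1 r2 ⊢
        have r3 : genBinom ((k : ℝ) + 1 + j + α) (j + 1) * genBinom ((k : ℝ) + 1 + j + β) k *
            ((j + 1) * (j + 1 + β)) = genBinom ((k : ℝ) + 1 + j + α) j *
            genBinom ((k : ℝ) + 1 + j + β) (k + 1) * ((k + 1) * (k + 1 + α)) := by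
          linear_combination (genBinom ((k : ℝ) + 1 + j + β) k * (j + 1 + β)) * r1 -
            (genBinom ((k : ℝ) + 1 + j + α) j * (k + 1 + α)) * r2
        have e3 : X / (X + 1) - 1 = -1 / (X + 1) := by field_simp; ring
        have e4 : 1 - (X + 1) / X = -1 / X := by field_simp; ring
        rw [e3, e4]
        calc _ = (genBinom ((k : ℝ) + 1 + j + α) (j + 1) * genBinom ((k : ℝ) + 1 + j + β) k *
            ((j + 1) * (j + 1 + β))) * (-(X ^ k * (X + 1) ^ j)) := by
              field_simp
              ring
          _ = _ := by
              rw [r3]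
              field_simp
              ring
    have e2 : k + j - k = j := by omega
    rw [hWk]
    simp only [hW, e2]
    rw [hx]
    push_cast
    field_simp
    ring
  have hsum := Finset.sum_congr rfl hterm
  rw [Finset.sum_range_sub'] at hsum
  have hW0 : W 0 = 0 := rfl
  have hW1 : W (n + 1) = 0 := by simp [hW]
  rw [hW0, hW1, sub_zero] at hsum
  rw [← hsum, jacobiDeriv₂, jacobiDeriv, jacobiP, Finset.mul_sum, Finset.mul_sum, Finset.mul_sum,
    ← Finset.sum_add_distrib, ← Finset.sum_add_distrib]
  refine Finset.sum_congr rfl fun k _ => ?_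
  rw [← hXe, hYe]
  ring

/-- A solution of a Riccati inequality `v' ≤ -(M² + v²)` blows up within length `π / M`. -/
theorem mul_length_lt_pi_of_riccati {v v' : ℝ → ℝ} {M a b : ℝ} (hM : 0 < M) (hab : a ≤ b)
    (hv : ∀ x ∈ Set.Icc a b, HasDerivAt v (v' x) x)
    (hle : ∀ x ∈ Set.Icc a b, v' x ≤ -(M ^ 2 + v x ^ 2)) : M * (b - a) < Real.pi := by
  have hh : ∀ x ∈ Set.Icc a b, HasDerivAt (fun x => Real.arctan (v x / M) + M * x)
      (1 / (1 + (v x / M) ^ 2) * (v' x / M) + M) x := fun x hx => by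
    have h1 := ((hv x hx).div_const M).arctan
    have h2 := (hasDerivAt_id x).const_mul M
    exact (h1.add h2).congr_deriv (by simp)
  have hanti : AntitoneOn (fun x => Real.arctan (v x / M) + M * x) (Set.Icc a b) := by
    apply antitoneOn_of_deriv_nonpos (convex_Icc a b)
    · exact fun x hx => (hh x hx).continuousAt.continuousWithinAt
    · exact fun x hx => (hh x (interior_subset hx)).differentiableAt.differentiableWithinAt
    · intro x hx
      have hx := interior_subset hx
      rw [(hh x hx).deriv]
      have h1 := hle x hx
      have e : 1 / (1 + (v x / M) ^ 2) * (v' x / M) + M =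
          M * (v' x + (M ^ 2 + v x ^ 2)) / (M ^ 2 + v x ^ 2) := by
        have : M ^ 2 + v x ^ 2 ≠ 0 := by positivity
        field_simp
      rw [e]
      exact div_nonpos_of_nonpos_of_nonneg
        (mul_nonpos_of_nonneg_of_nonpos hM.le (by linarith)) (by positivity)
  have h1 := hanti ⟨le_rfl, hab⟩ ⟨hab, le_rfl⟩ hab
  simp only at h1
  have h2 := Real.arctan_lt_pi_div_two (v a / M)
  have h3 := Real.neg_pi_div_two_lt_arctan (v b / M)
  nlinarith

theorem exists_jacobiP_zero (n : ℕ) (α β : ℝ) {M a b : ℝ} (hM : 0 < M) (hab : a ≤ b)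
    (ha : -1 < a) (hb : b < 1)
    (hQ : ∀ x ∈ Set.Icc a b, M ^ 2 * (1 - x) ^ 2 * (1 + x) ^ 2 ≤
      ((1 - α ^ 2) * (1 + x) ^ 2 + (1 - β ^ 2) * (1 - x) ^ 2 +
        (4 * n * (n + α + β + 1) + 2 * (α + 1) * (β + 1)) * ((1 + x) * (1 - x))) / 4)
    (hlen : Real.pi ≤ M * (b - a)) :
    ∃ x ∈ Set.Icc a b, jacobiP n α β x = 0 := by
  by_contra! hne
  set g : ℝ → ℝ := fun x => (β + 1) / (2 * (1 + x)) - (α + 1) / (2 * (1 - x)) with hg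
  refine absurd (mul_length_lt_pi_of_riccati
    (v := fun x => jacobiDeriv n α β x / jacobiP n α β x + g x)
    (v' := fun x => (jacobiDeriv₂ n α β x * jacobiP n α β x -
      jacobiDeriv n α β x * jacobiDeriv n α β x) / jacobiP n α β x ^ 2 +
      (-(β + 1) / (2 * (1 + x) ^ 2) - (α + 1) / (2 * (1 - x) ^ 2))) hM hab ?_ ?_) (not_lt.2 hlen)
  · intro x hx
    have h1 : 1 + x ≠ 0 := by linarith [hx.1]
    have h2 : 1 - x ≠ 0 := by linarith [hx.2]
    have hX : (x - 1) / 2 ≠ 0 := by intro h; apply h2; linarith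
    have hY : (x + 1) / 2 ≠ 0 := by intro h; apply h1; linarith
    have d1 := (hasDerivAt_jacobiDeriv n α β hX hY).div (hasDerivAt_jacobiP n α β hX hY) (hne x hx)
    have d2 := (hasDerivAt_const x (β + 1)).div (((hasDerivAt_id x).const_add 1).const_mul 2)
      (mul_ne_zero two_ne_zero h1)
    have d3 := (hasDerivAt_const x (α + 1)).div (((hasDerivAt_id x).const_sub 1).const_mul 2)
      (mul_ne_zero two_ne_zero h2)
    refine (d1.add (d2.sub d3)).congr_deriv ?_
    simp only [id]
    field_simp
    ring
  · intro x hx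
    have h1 : 0 < 1 + x := by linarith [hx.1]
    have h2 : 0 < 1 - x := by linarith [hx.2]
    have hX : (x - 1) / 2 ≠ 0 := by intro h; linarith
    have hY : (x + 1) / 2 ≠ 0 := by intro h; linarith
    have hode := jacobiP_ode n α β hX hY
    have hy := hne x hx
    have hq := hQ x hx
    simp only [hg]
    obtain ⟨w, hw⟩ : ∃ w, w = jacobiDeriv n α β x / jacobiP n α β x := ⟨_, rfl⟩
    have e1 : (jacobiDeriv₂ n α β x * jacobiP n α β x - jacobiDeriv n α β x * jacobiDeriv n α β x) /
        jacobiP n α β x ^ 2 = jacobiDeriv₂ n α β x / jacobiP n α β x - w ^ 2 := by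
      rw [hw]; field_simp
    have e2 : jacobiDeriv₂ n α β x / jacobiP n α β x =
        -((β - α - (α + β + 2) * x) * w + n * (n + α + β + 1)) / ((1 + x) * (1 - x)) := by
      rw [hw]
      field_simp
      linear_combination hode
    rw [e1, e2, ← hw]
    have e3 : M ^ 2 ≤ (((1 - α ^ 2) * (1 + x) ^ 2 + (1 - β ^ 2) * (1 - x) ^ 2 +
        (4 * n * (n + α + β + 1) + 2 * (α + 1) * (β + 1)) * ((1 + x) * (1 - x))) / 4) /
        ((1 - x) ^ 2 * (1 + x) ^ 2) := by
      rw [le_div_iff₀ (by positivity)]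
      linarith
    have e4 : -((β - α - (α + β + 2) * x) * w + n * (n + α + β + 1)) / ((1 + x) * (1 - x)) - w ^ 2 +
        (-(β + 1) / (2 * (1 + x) ^ 2) - (α + 1) / (2 * (1 - x) ^ 2)) =
        -((((1 - α ^ 2) * (1 + x) ^ 2 + (1 - β ^ 2) * (1 - x) ^ 2 +
        (4 * n * (n + α + β + 1) + 2 * (α + 1) * (β + 1)) * ((1 + x) * (1 - x))) / 4) /
        ((1 - x) ^ 2 * (1 + x) ^ 2) +
        (w + ((β + 1) / (2 * (1 + x)) - (α + 1) / (2 * (1 - x)))) ^ 2) := by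
      field_simp
      ring
    rw [e4]
    linarith

theorem jacobiP_zeros_finite_ncard_le (n : ℕ) {α : ℝ} (β : ℝ) (hα : -1 < α) :
    {x : ℝ | jacobiP n α β x = 0}.Finite ∧ {x : ℝ | jacobiP n α β x = 0}.ncard ≤ n := by
  open Polynomial in
  set P : ℝ[X] := ∑ k ∈ Finset.range (n + 1),
    C (genBinom ((n : ℝ) + α) (n - k) * genBinom ((n : ℝ) + β) k) *
      (C (1 / 2) * X + C (-1 / 2)) ^ k * (C (1 / 2) * X + C (1 / 2)) ^ (n - k) with hP
  have heval : ∀ x, P.eval x = jacobiP n α β x := by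
    intro x
    rw [hP, jacobiP, Polynomial.eval_finsetSum]
    refine Finset.sum_congr rfl fun k _ => ?_
    simp only [Polynomial.eval_mul, Polynomial.eval_pow, Polynomial.eval_add, Polynomial.eval_C,
      Polynomial.eval_X]
    congr 2 <;> ring
  have hdeg : P.natDegree ≤ n := by
    refine Polynomial.natDegree_sum_le_of_forall_le _ _ fun k hk => ?_
    have hk' : k + (n - k) = n := by
      have := Finset.mem_range.1 hk
      omega
    refine (Polynomial.natDegree_mul_le_of_le (Polynomial.natDegree_C_mul_le _ _)
      (Polynomial.natDegree_pow_le_of_le (n - k) (Polynomial.natDegree_linear_le))).trans ?_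
    have := Polynomial.natDegree_pow_le_of_le k
      (Polynomial.natDegree_linear_le (a := (1 / 2 : ℝ)) (b := -1 / 2))
    omega
  have hone : jacobiP n α β 1 = genBinom ((n : ℝ) + α) n := by
    rw [jacobiP, Finset.sum_range_succ', Finset.sum_eq_zero]
    · simp [genBinom]
    · intro k _
      simp
  have hne : P ≠ 0 := by
    intro h
    have h1 := heval 1
    rw [h, hone, Polynomial.eval_zero, genBinom, eq_comm, div_eq_zero_iff] at h1
    rcases h1 with h1 | h1
    · refine absurd h1 (Finset.prod_pos fun i hi => ?_).ne'
      have : (i : ℝ) + 1 ≤ n := by exact_mod_cast Finset.mem_range.1 hi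
      linarith
    · exact absurd h1 (by positivity)
  have hset : {x : ℝ | jacobiP n α β x = 0} = (P.roots.toFinset : Set ℝ) := by
    ext x
    simp [hne, heval]
  rw [hset]
  refine ⟨Finset.finite_toSet _, ?_⟩
  rw [Set.ncard_coe_finset]
  exact (Multiset.toFinset_card_le _).trans ((Polynomial.card_roots' P).trans hdeg)

theorem le_ncard_of_exists_mem_subinterval {Z : Set ℝ} (hfin : Z.Finite) {c d ℓ : ℝ}
    (hcd : c < d) {k : ℕ} (hk : k * ℓ < d - c)
    (hZ : ∀ a, c < a → a + ℓ ≤ d → ∃ x ∈ Set.Icc a (a + ℓ), x ∈ Z) :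
    k ≤ (Z ∩ Set.Ioc c d).ncard := by
  rcases Nat.eq_zero_or_pos k with rfl | hk0
  · exact Nat.zero_le _
  have hkr : (0 : ℝ) < k := by exact_mod_cast hk0
  set h : ℝ := (d - c) / k with hh
  have hh0 : 0 < h := div_pos (sub_pos.2 hcd) hkr
  have hkh : k * h = d - c := by rw [hh]; field_simp
  have hℓ : ℓ < h := by rw [hh, lt_div_iff₀ hkr]; linarith
  have hex : ∀ i : ℕ, i < k → ∃ x ∈ Z, c + i * h < x ∧ x ≤ c + (i + 1) * h := by
    intro i hi
    have hi1 : (i : ℝ) + 1 ≤ k := by exact_mod_cast hi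
    have h1 : (i + 1) * h ≤ k * h := by gcongr
    have h2 : 0 ≤ i * h := by positivity
    obtain ⟨x, hx, hxZ⟩ := hZ (c + (i + 1) * h - ℓ) (by nlinarith) (by linarith)
    exact ⟨x, hxZ, by nlinarith [hx.1], by linarith [hx.2]⟩
  choose! z hz using hex
  have hlt : ∀ i j, i < k → j < k → i < j → z i < z j := by
    intro i j hi hj hij
    have h1 : (i : ℝ) + 1 ≤ j := by exact_mod_cast hij
    have h2 : ((i : ℝ) + 1) * h ≤ j * h := by gcongr
    linarith [(hz i hi).2.2, (hz j hj).2.1]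
  have hinj : Set.InjOn z (Finset.range k : Set ℕ) := by
    intro i hi j hj hij
    have hi := Finset.mem_range.1 (Finset.mem_coe.1 hi)
    have hj := Finset.mem_range.1 (Finset.mem_coe.1 hj)
    rcases lt_trichotomy i j with h | h | h
    · exact absurd hij (hlt i j hi hj h).ne
    · exact h
    · exact absurd hij (hlt j i hj hi h).ne'
  have hsub : z '' (Finset.range k : Set ℕ) ⊆ Z ∩ Set.Ioc c d := by
    rintro _ ⟨i, hi, rfl⟩
    have hi := Finset.mem_range.1 (Finset.mem_coe.1 hi)
    obtain ⟨h1, h2, h3⟩ := hz i hi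
    have hi1 : (i : ℝ) + 1 ≤ k := by exact_mod_cast hi
    have h4 : (i + 1) * h ≤ k * h := by gcongr
    have h5 : 0 ≤ i * h := by positivity
    exact ⟨h1, by linarith, by linarith⟩
  have := Set.ncard_le_ncard hsub (hfin.inter_of_left _)
  rwa [hinj.ncard_image, Set.ncard_coe_finset, Finset.card_range] at this

/-- The four rescaled recurrence data of the Jacobi polynomials. -/
noncomputable def jacobiA₁ (n α β δ ε : ℝ) : ℝ :=
  2 * ((1 / δ) * ((n + β) / (2 * n + α + β) - ε))

/-- See `jacobiA₁`. -/
noncomputable def jacobiA₂ (n α β δ ε : ℝ) : ℝ :=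
  2 * ((1 / δ) * ((n * (n + α) + (n + β) * (n + α + β)) / (2 * n + α + β) ^ 2 - ε))

/-- See `jacobiA₁`. -/
noncomputable def jacobiB₁ (n α β δ : ℝ) : ℝ :=
  4 * ((1 / δ ^ 2) * ((n + β) * (n + α) * n / (2 * n + α + β) ^ 3))

/-- See `jacobiA₁`. -/
noncomputable def jacobiB₂ (n α β δ : ℝ) : ℝ :=
  4 * ((1 / δ ^ 2) * ((n + β) * (n + α) * (n + α + β) * n / (2 * n + α + β) ^ 4))

theorem jacobiB₁_pos {n α β δ : ℝ} (hn : 2 ≤ n) (hα : -1 < α) (hβ : -1 < β) (hδ : 0 < δ) :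
    0 < jacobiB₁ n α β δ := by
  have h1 : 0 < n + α := by linarith
  have h2 : 0 < n + β := by linarith
  have h3 : 0 < 2 * n + α + β := by linarith
  rw [jacobiB₁]
  positivity

theorem jacobiB₂_eq {n α β δ : ℝ} (hn : 2 ≤ n) (hα : -1 < α) (hβ : -1 < β) :
    jacobiB₂ n α β δ = jacobiB₁ n α β δ * ((n + α + β) / (2 * n + α + β)) := by
  have h3 : 2 * n + α + β ≠ 0 := by linarith
  rw [jacobiB₁, jacobiB₂]
  field_simp

theorem jacobiB₂_le_jacobiB₁ {n α β δ : ℝ} (hn : 2 ≤ n) (hα : -1 < α) (hβ : -1 < β)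
    (hδ : 0 < δ) : jacobiB₂ n α β δ ≤ jacobiB₁ n α β δ := by
  rw [jacobiB₂_eq hn hα hβ]
  refine mul_le_of_le_one_right (jacobiB₁_pos hn hα hβ hδ).le ?_
  rw [div_le_one (by linarith)]
  linarith

theorem jacobiB₁_le_two_mul_jacobiB₂_add {n α β δ : ℝ} (hn : 2 ≤ n) (hα : -1 < α) (hβ : -1 < β)
    (hδ : 0 < δ) :
    jacobiB₁ n α β δ ≤ 2 * jacobiB₂ n α β δ + jacobiB₁ n α β δ * (1 / (n - 1)) := by
  have h1 : 0 < 2 * n + α + β := by linarith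
  have h2 : 0 < n - 1 := by linarith
  have h3 : 1 ≤ 2 * ((n + α + β) / (2 * n + α + β)) + 1 / (n - 1) := by
    rw [← sub_nonneg]
    have : 2 * ((n + α + β) / (2 * n + α + β)) + 1 / (n - 1) - 1 =
        (2 * n + α + β + (n - 1) * (α + β)) / ((2 * n + α + β) * (n - 1)) := by
      field_simp
      ring
    rw [this]
    refine div_nonneg ?_ (by positivity)
    nlinarith
  rw [jacobiB₂_eq hn hα hβ]
  nlinarith [jacobiB₁_pos hn hα hβ hδ]

theorem jacobiB₂_mul_sq_le {n α β δ : ℝ} (ε : ℝ) (hn : 2 ≤ n) (hα : -1 < α) (hβ : -1 < β)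
    (hδ : 0 < δ) :
    jacobiB₂ n α β δ * (jacobiA₂ n α β δ ε - jacobiA₁ n α β δ ε) ^ 2 ≤
      (2 * jacobiB₂ n α β δ - jacobiB₁ n α β δ) ^ 2 + jacobiB₁ n α β δ ^ 2 * (1 / (n - 1)) := by
  have h1 : 0 < 2 * n + α + β := by linarith
  have h2 : 0 < n - 1 := by linarith
  have h3 : 0 < n + α := by linarith
  have h4 : 0 < n + β := by linarith
  have hn0 : 0 < n := by linarith
  rw [← sub_nonneg]
  have : (2 * jacobiB₂ n α β δ - jacobiB₁ n α β δ) ^ 2 + jacobiB₁ n α β δ ^ 2 * (1 / (n - 1)) -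
      jacobiB₂ n α β δ * (jacobiA₂ n α β δ ε - jacobiA₁ n α β δ ε) ^ 2 =
      16 * n ^ 2 * (n + α) * (n + β) * (n * (n - 1) + n * (1 + α) * (1 + β)) /
        (δ ^ 4 * (2 * n + α + β) ^ 6 * (n - 1)) := by
    rw [jacobiB₁, jacobiB₂, jacobiA₁, jacobiA₂]
    field_simp
    ring
  rw [this]
  have h5 : 0 < 1 + α := by linarith
  have h6 : 0 < 1 + β := by linarith
  positivity

theorem densityDenom_jacobi {n α β δ : ℝ} (ε t : ℝ) (hn : 2 ≤ n) (hα : -1 < α) (hβ : -1 < β)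
    (hδ : 0 < δ) :
    densityDenom (jacobiA₁ n α β δ ε) (jacobiA₂ n α β δ ε) (jacobiB₁ n α β δ) (jacobiB₂ n α β δ) t =
      jacobiB₁ n α β δ * (4 * (n / (2 * n + α + β)) / δ ^ 2) *
        ((ε + δ * t / 2) * (1 - (ε + δ * t / 2))) := by
  have hS : 2 * n + α + β ≠ 0 := by linarith
  obtain ⟨S, hSe⟩ : ∃ S, S = 2 * n + α + β := ⟨_, rfl⟩
  rw [← hSe] at hS
  obtain ⟨p, hp⟩ : ∃ p, p = n / S := ⟨_, rfl⟩
  obtain ⟨r, hr⟩ : ∃ r, r = (n + β) / S := ⟨_, rfl⟩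
  have e1 : n = p * S := by rw [hp, div_mul_cancel₀ _ hS]
  have e2 : n + β = r * S := by rw [hr, div_mul_cancel₀ _ hS]
  have e3 : n + α = (1 - r) * S := by linarith
  have e4 : n + α + β = (1 - p) * S := by linarith
  have hB₁ : jacobiB₁ n α β δ = 4 * (p * (1 - r) * r) / δ ^ 2 := by
    rw [jacobiB₁, ← hSe, e3, e2, e1]
    field_simp
  have hB₂ : jacobiB₂ n α β δ = 4 * (p * (1 - r) * r * (1 - p)) / δ ^ 2 := by
    rw [jacobiB₂, ← hSe, e4, e3, e2, e1]
    field_simp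
  have hA₁ : jacobiA₁ n α β δ ε = 2 * (r - ε) / δ := by
    rw [jacobiA₁, ← hSe, hr]
    ring
  have hA₂ : jacobiA₂ n α β δ ε = 2 * (p * (1 - r) + r * (1 - p) - ε) / δ := by
    rw [jacobiA₂, ← hSe, e4, e3, e2, e1]
    field_simp
  obtain ⟨u, hu⟩ : ∃ u, u = ε + δ * t / 2 := ⟨_, rfl⟩
  have ht : t = 2 * (u - ε) / δ := by
    rw [hu]
    field_simp
    ring
  rw [← hSe, ← hp, ← hu, densityDenom, hA₁, hA₂, hB₁, hB₂, ht]
  field_simp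
  ring

theorem sq_mul_radicand_jacobi {n α β δ : ℝ} (ε t : ℝ) (hn : 2 ≤ n) (hα : -1 < α) (hβ : -1 < β)
    (hδ : 0 < δ) :
    (2 * n + α + β) ^ 2 * (δ ^ 2 * (4 * jacobiB₂ n α β δ - (t - jacobiA₂ n α β δ ε) ^ 2) / 4) +
        1 + 2 * (2 * n + α + β) * ((ε + δ * t / 2) * (1 - (ε + δ * t / 2))) =
      (1 - α ^ 2) * (ε + δ * t / 2) ^ 2 + (1 - β ^ 2) * (1 - (ε + δ * t / 2)) ^ 2 +
        (4 * n * (n + α + β + 1) + 2 * (α + 1) * (β + 1)) *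
          ((ε + δ * t / 2) * (1 - (ε + δ * t / 2))) := by
  have h1 : 2 * n + α + β ≠ 0 := by linarith
  rw [jacobiB₂, jacobiA₂]
  field_simp
  ring

theorem jacobi_potential_bound {n α β δ ε t μ : ℝ} (hn : 2 ≤ n) (hα : -1 < α) (hβ : -1 < β)
    (hδ : 0 < δ)
    (hD : 0 < densityDenom (jacobiA₁ n α β δ ε) (jacobiA₂ n α β δ ε) (jacobiB₁ n α β δ)
      (jacobiB₂ n α β δ) t)
    (hlt : (2 * Real.pi * μ) ^ 2 * densityDenom (jacobiA₁ n α β δ ε) (jacobiA₂ n α β δ ε)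
      (jacobiB₁ n α β δ) (jacobiB₂ n α β δ) t ^ 2 <
        jacobiB₁ n α β δ ^ 2 * (4 * jacobiB₂ n α β δ - (t - jacobiA₂ n α β δ ε) ^ 2))
    {x : ℝ} (hx : x = δ * t + 2 * ε - 1) :
    -1 < x ∧ x < 1 ∧ (Real.pi * μ * n / δ) ^ 2 * (1 - x) ^ 2 * (1 + x) ^ 2 ≤
      ((1 - α ^ 2) * (1 + x) ^ 2 + (1 - β ^ 2) * (1 - x) ^ 2 +
        (4 * n * (n + α + β + 1) + 2 * (α + 1) * (β + 1)) * ((1 + x) * (1 - x))) / 4 := by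
  have hS : 0 < 2 * n + α + β := by linarith
  have hn0 : 0 < n := by linarith
  have hB := jacobiB₁_pos hn hα hβ hδ
  have hid := sq_mul_radicand_jacobi ε t hn hα hβ hδ
  rw [densityDenom_jacobi ε t hn hα hβ hδ] at hD hlt
  obtain ⟨u, hu⟩ : ∃ u, u = ε + δ * t / 2 := ⟨_, rfl⟩
  have hxu : x = 2 * u - 1 := by rw [hx, hu]; ring
  rw [← hu] at hD hlt hid
  have hpos : 0 < u * (1 - u) := pos_of_mul_pos_right hD (by positivity)
  have hu0 : 0 < u := by nlinarith
  have hu1 : u < 1 := by nlinarith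
  refine ⟨by linarith, by linarith, ?_⟩
  obtain ⟨R, hR⟩ : ∃ R, R = 4 * jacobiB₂ n α β δ - (t - jacobiA₂ n α β δ ε) ^ 2 := ⟨_, rfl⟩
  rw [← hR] at hlt hid
  have h1 : (2 * Real.pi * μ) ^ 2 * (4 * (n / (2 * n + α + β)) / δ ^ 2 * (u * (1 - u))) ^ 2 < R := by
    have : jacobiB₁ n α β δ ^ 2 * ((2 * Real.pi * μ) ^ 2 *
        (4 * (n / (2 * n + α + β)) / δ ^ 2 * (u * (1 - u))) ^ 2) < jacobiB₁ n α β δ ^ 2 * R := by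
      linarith
    exact lt_of_mul_lt_mul_left this (by positivity)
  have h2 : (Real.pi * μ * n / δ) ^ 2 * (16 * (u * (1 - u)) ^ 2) =
      (2 * n + α + β) ^ 2 * (δ ^ 2 * ((2 * Real.pi * μ) ^ 2 *
        (4 * (n / (2 * n + α + β)) / δ ^ 2 * (u * (1 - u))) ^ 2) / 4) := by
    generalize 2 * n + α + β = S at hS
    field_simp
    ring
  have h3 : (2 * n + α + β) ^ 2 * (δ ^ 2 * ((2 * Real.pi * μ) ^ 2 *
        (4 * (n / (2 * n + α + β)) / δ ^ 2 * (u * (1 - u))) ^ 2) / 4) ≤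
      (2 * n + α + β) ^ 2 * (δ ^ 2 * R / 4) := by gcongr
  have h4 : 0 < (2 * n + α + β) * (u * (1 - u)) := by positivity
  rw [hxu]
  linarith

theorem densityDenom_pos {a1 a2 b1 b2 t : ℝ} (hb2 : 0 < b2) (h12 : b2 ≤ b1) (h21 : b1 ≤ 2 * b2)
    (hd : b2 * (a2 - a1) ^ 2 ≤ (2 * b2 - b1) ^ 2) (h1 : a2 - 2 * √b2 < t) (h2 : t < a2 + 2 * √b2) :
    0 < densityDenom a1 a2 b1 b2 t := by
  obtain ⟨ρ, σ, -, -, -, -, h⟩ := exists_densityDenom_factorization hb2 h12 h21 hd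
  have hs : 0 < √b2 := Real.sqrt_pos.2 hb2
  obtain ⟨c, hc⟩ : ∃ c, c = (t - a2) / (2 * √b2) := ⟨_, rfl⟩
  have ht : t = a2 + 2 * √b2 * c := by
    rw [hc]
    field_simp
    ring
  have hc1 : -1 < c := by
    rw [hc, lt_div_iff₀ (by positivity)]
    linarith
  have hc2 : c < 1 := by
    rw [hc, div_lt_iff₀ (by positivity)]
    linarith
  have hpos : ∀ τ : ℝ, 0 < 1 - 2 * τ * c + τ ^ 2 := fun τ => by nlinarith [sq_nonneg (τ - c)]
  rw [ht, h]
  have := hpos ρ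
  have := hpos σ
  positivity

theorem jacobi_limit_constraints {α β δ ε : ℕ → ℝ} {a1 a2 b1 b2 : ℝ}
    (hα : ∀ n, -1 < α n) (hβ : ∀ n, -1 < β n) (hδ : ∀ n, 0 < δ n)
    (hA₁ : Tendsto (fun n : ℕ => jacobiA₁ n (α n) (β n) (δ n) (ε n)) atTop (𝓝 a1))
    (hA₂ : Tendsto (fun n : ℕ => jacobiA₂ n (α n) (β n) (δ n) (ε n)) atTop (𝓝 a2))
    (hB₁ : Tendsto (fun n : ℕ => jacobiB₁ n (α n) (β n) (δ n)) atTop (𝓝 b1))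
    (hB₂ : Tendsto (fun n : ℕ => jacobiB₂ n (α n) (β n) (δ n)) atTop (𝓝 b2)) :
    b2 ≤ b1 ∧ b1 ≤ 2 * b2 ∧ b2 * (a2 - a1) ^ 2 ≤ (2 * b2 - b1) ^ 2 := by
  have hn : ∀ᶠ n : ℕ in atTop, (2 : ℝ) ≤ n :=
    tendsto_natCast_atTop_atTop.eventually_ge_atTop 2
  have hinv : Tendsto (fun n : ℕ => 1 / ((n : ℝ) - 1)) atTop (𝓝 0) := by
    simp only [one_div]
    exact (tendsto_atTop_add_const_right _ (-1) tendsto_natCast_atTop_atTop).inv_tendsto_atTop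
  refine ⟨le_of_tendsto_of_tendsto hB₂ hB₁ ?_, ?_, ?_⟩
  · filter_upwards [hn] with n hn
    exact jacobiB₂_le_jacobiB₁ hn (hα n) (hβ n) (hδ n)
  · have h := le_of_tendsto_of_tendsto hB₁ ((hB₂.const_mul 2).add (hB₁.mul hinv)) (by
      filter_upwards [hn] with n hn
      exact jacobiB₁_le_two_mul_jacobiB₂_add hn (hα n) (hβ n) (hδ n))
    simpa using h
  · have h := le_of_tendsto_of_tendsto (hB₂.mul ((hA₂.sub hA₁).pow 2))
      ((((hB₂.const_mul 2).sub hB₁).pow 2).add ((hB₁.pow 2).mul hinv)) (by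
      filter_upwards [hn] with n hn
      exact jacobiB₂_mul_sq_le (ε n) hn (hα n) (hβ n) (hδ n))
    simpa using h

theorem eventually_jacobi_density_lt {α β δ ε : ℕ → ℝ} {a1 a2 b1 b2 : ℝ}
    (hA₁ : Tendsto (fun n : ℕ => jacobiA₁ n (α n) (β n) (δ n) (ε n)) atTop (𝓝 a1))
    (hA₂ : Tendsto (fun n : ℕ => jacobiA₂ n (α n) (β n) (δ n) (ε n)) atTop (𝓝 a2))
    (hB₁ : Tendsto (fun n : ℕ => jacobiB₁ n (α n) (β n) (δ n)) atTop (𝓝 b1))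
    (hB₂ : Tendsto (fun n : ℕ => jacobiB₂ n (α n) (β n) (δ n)) atTop (𝓝 b2)) {c d κ : ℝ}
    (h : ∀ t ∈ Set.Icc c d, 0 < densityDenom a1 a2 b1 b2 t ∧
      κ * densityDenom a1 a2 b1 b2 t ^ 2 < b1 ^ 2 * (4 * b2 - (t - a2) ^ 2)) :
    ∀ᶠ n : ℕ in atTop, ∀ t ∈ Set.Icc c d,
      0 < densityDenom (jacobiA₁ n (α n) (β n) (δ n) (ε n)) (jacobiA₂ n (α n) (β n) (δ n) (ε n))
        (jacobiB₁ n (α n) (β n) (δ n)) (jacobiB₂ n (α n) (β n) (δ n)) t ∧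
      κ * densityDenom (jacobiA₁ n (α n) (β n) (δ n) (ε n)) (jacobiA₂ n (α n) (β n) (δ n) (ε n))
        (jacobiB₁ n (α n) (β n) (δ n)) (jacobiB₂ n (α n) (β n) (δ n)) t ^ 2 <
        jacobiB₁ n (α n) (β n) (δ n) ^ 2 *
          (4 * jacobiB₂ n (α n) (β n) (δ n) - (t - jacobiA₂ n (α n) (β n) (δ n) (ε n)) ^ 2) := by
  have hlim := hA₁.prodMk_nhds (hA₂.prodMk_nhds (hB₁.prodMk_nhds hB₂))
  refine hlim.eventually (p := fun P : ℝ × ℝ × ℝ × ℝ => ∀ t ∈ Set.Icc c d,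
    0 < densityDenom P.1 P.2.1 P.2.2.1 P.2.2.2 t ∧
      κ * densityDenom P.1 P.2.1 P.2.2.1 P.2.2.2 t ^ 2 <
        P.2.2.1 ^ 2 * (4 * P.2.2.2 - (t - P.2.1) ^ 2))
    (isCompact_Icc.eventually_forall_of_forall_eventually fun t ht => ?_)
  have hcont : Continuous fun z : (ℝ × ℝ × ℝ × ℝ) × ℝ =>
      densityDenom z.1.1 z.1.2.1 z.1.2.2.1 z.1.2.2.2 z.2 := by
    unfold densityDenom
    fun_prop
  refine IsOpen.mem_nhds (IsOpen.inter (isOpen_lt continuous_const hcont)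
    (isOpen_lt (continuous_const.mul (hcont.pow 2)) ?_)) (h t ht)
  fun_prop

theorem sq_mul_lt_of_lt_div {μ b1 D R : ℝ} (hμ : 0 < μ) (hD : 0 < D)
    (h : μ < b1 / (2 * Real.pi) * √R / D) : (2 * Real.pi * μ) ^ 2 * D ^ 2 < b1 ^ 2 * R := by
  have h1 : 2 * Real.pi * μ * D < b1 * √R := by
    rw [lt_div_iff₀ hD, div_mul_eq_mul_div, lt_div_iff₀ (by positivity)] at h
    linarith
  have hR : 0 < R := by
    by_contra hR
    rw [Real.sqrt_eq_zero'.2 (not_lt.1 hR), mul_zero] at h1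
    exact absurd h1 (not_lt.2 (by positivity))
  calc (2 * Real.pi * μ) ^ 2 * D ^ 2 = (2 * Real.pi * μ * D) ^ 2 := by ring
    _ < (b1 * √R) ^ 2 := by gcongr
    _ = b1 ^ 2 * R := by rw [mul_pow, Real.sq_sqrt hR.le]

/-- The zeros of the Jacobi polynomial in the rescaled variable. -/
def rescaledZeros (n : ℕ) (α β δ ε : ℝ) : Set ℝ :=
  {t | jacobiP n α β (δ * t + 2 * ε - 1) = 0}

theorem image_rescaledZeros_inter (n : ℕ) (α β : ℝ) {δ : ℝ} (ε : ℝ) (hδ : 0 < δ) (I : Set ℝ) :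
    (fun t => δ * t + 2 * ε - 1) '' (rescaledZeros n α β δ ε ∩ I) =
      {x | jacobiP n α β x = 0} ∩ (fun x => (x + 1 - 2 * ε) / δ) ⁻¹' I := by
  ext x
  constructor
  · rintro ⟨t, ⟨ht, hI⟩, rfl⟩
    refine ⟨ht, ?_⟩
    have : (δ * t + 2 * ε - 1 + 1 - 2 * ε) / δ = t := by
      field_simp
      ring
    simpa only [Set.mem_preimage, this] using hI
  · rintro ⟨hx, hI⟩
    have : δ * ((x + 1 - 2 * ε) / δ) + 2 * ε - 1 = x := by
      field_simp
      ring
    refine ⟨_, ⟨?_, hI⟩, this⟩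
    simpa only [rescaledZeros, Set.mem_ofPred_eq, this] using hx

theorem ncard_rescaledZeros_inter (n : ℕ) (α β : ℝ) {δ : ℝ} (ε : ℝ) (hδ : 0 < δ) (I : Set ℝ) :
    (rescaledZeros n α β δ ε ∩ I).ncard =
      ({x | jacobiP n α β x = 0} ∩ (fun x => (x + 1 - 2 * ε) / δ) ⁻¹' I).ncard := by
  rw [← image_rescaledZeros_inter n α β ε hδ, Set.ncard_image_of_injective]
  intro s t h
  have h : δ * s + 2 * ε - 1 = δ * t + 2 * ε - 1 := h
  exact mul_left_cancel₀ hδ.ne' (by linarith)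

theorem rescaledZeros_finite (n : ℕ) {α : ℝ} (β : ℝ) {δ : ℝ} (ε : ℝ) (hα : -1 < α) (hδ : 0 < δ) :
    (rescaledZeros n α β δ ε).Finite := by
  refine (jacobiP_zeros_finite_ncard_le n β hα).1.preimage fun s _ t _ h => ?_
  have h : δ * s + 2 * ε - 1 = δ * t + 2 * ε - 1 := h
  exact mul_left_cancel₀ hδ.ne' (by linarith)

theorem ncard_rescaledZeros_le (n : ℕ) {α : ℝ} (β : ℝ) {δ : ℝ} (ε : ℝ) (hα : -1 < α)
    (hδ : 0 < δ) : (rescaledZeros n α β δ ε).ncard ≤ n := by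
  have h := ncard_rescaledZeros_inter n α β ε hδ Set.univ
  rw [Set.inter_univ, Set.preimage_univ, Set.inter_univ] at h
  exact h.le.trans (jacobiP_zeros_finite_ncard_le n β hα).2

theorem jacobiN_eq_ncard_rescaledZeros (n : ℕ) (α β : ℝ) {δ : ℝ} (ε ξ : ℝ) (hδ : 0 < δ) :
    jacobiN n α β (δ * ξ + 2 * ε - 1) = (rescaledZeros n α β δ ε ∩ Set.Iic ξ).ncard := by
  rw [ncard_rescaledZeros_inter n α β ε hδ, jacobiN]
  congr 1
  ext x
  simp only [Set.mem_ofPred_eq, Set.mem_inter_iff, Set.mem_preimage, Set.mem_Iic, div_le_iff₀ hδ]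
  refine and_congr_right fun _ => ⟨fun h => ?_, fun h => ?_⟩ <;> linarith

/-- A pointwise lower bound on the potential of the rescaled Jacobi equation forces many zeros. -/
theorem le_ncard_rescaledZeros {n : ℕ} {α β δ ε c d μ : ℝ} (hn : (2 : ℝ) ≤ n) (hα : -1 < α)
    (hβ : -1 < β) (hδ : 0 < δ) (hcd : c < d) (hμ : 0 < μ)
    (h : ∀ t ∈ Set.Icc c d,
      0 < densityDenom (jacobiA₁ n α β δ ε) (jacobiA₂ n α β δ ε) (jacobiB₁ n α β δ)
        (jacobiB₂ n α β δ) t ∧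
      (2 * Real.pi * μ) ^ 2 * densityDenom (jacobiA₁ n α β δ ε) (jacobiA₂ n α β δ ε)
        (jacobiB₁ n α β δ) (jacobiB₂ n α β δ) t ^ 2 <
        jacobiB₁ n α β δ ^ 2 * (4 * jacobiB₂ n α β δ - (t - jacobiA₂ n α β δ ε) ^ 2)) :
    (n : ℝ) * (d - c) * μ - 1 ≤ ((rescaledZeros n α β δ ε ∩ Set.Ioc c d).ncard : ℝ) := by
  have hn0 : (0 : ℝ) < n := by linarith
  have hy : 0 < (n : ℝ) * (d - c) * μ := by
    have := sub_pos.2 hcd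
    positivity
  obtain ⟨k, hk1, hk2⟩ : ∃ k : ℕ, (n : ℝ) * (d - c) * μ - 1 ≤ k ∧ k < (n : ℝ) * (d - c) * μ := by
    obtain ⟨k, hk⟩ := Nat.exists_eq_succ_of_ne_zero (Nat.ceil_pos.2 hy).ne'
    have h1 := Nat.le_ceil ((n : ℝ) * (d - c) * μ)
    have h2 := Nat.ceil_lt_add_one hy.le
    rw [hk] at h1 h2
    push_cast at h1 h2
    exact ⟨k, by linarith, by linarith⟩
  refine hk1.trans (Nat.cast_le.2 ?_)
  refine le_ncard_of_exists_mem_subinterval (ℓ := 1 / (μ * n))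
    (rescaledZeros_finite n β ε hα hδ) hcd ?_ fun a ha had => ?_
  · rw [mul_one_div, div_lt_iff₀ (by positivity)]
    linarith
  · have hℓ : 0 < 1 / (μ * n) := by positivity
    have hb : ∀ x ∈ Set.Icc (δ * a + 2 * ε - 1) (δ * (a + 1 / (μ * n)) + 2 * ε - 1),
        (x + 1 - 2 * ε) / δ ∈ Set.Icc a (a + 1 / (μ * n)) ∧
          x = δ * ((x + 1 - 2 * ε) / δ) + 2 * ε - 1 := by
      rintro x ⟨hx1, hx2⟩
      refine ⟨⟨?_, ?_⟩, ?_⟩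
      · rw [le_div_iff₀ hδ]
        linarith
      · rw [div_le_iff₀ hδ]
        linarith
      · field_simp
        ring
    have hQ := fun x (hx : x ∈ Set.Icc (δ * a + 2 * ε - 1) (δ * (a + 1 / (μ * n)) + 2 * ε - 1)) =>
      have ht : (x + 1 - 2 * ε) / δ ∈ Set.Icc c d :=
        ⟨ha.le.trans (hb x hx).1.1, (hb x hx).1.2.trans had⟩
      jacobi_potential_bound hn hα hβ hδ (h _ ht).1 (h _ ht).2 (hb x hx).2
    have hle : δ * a + 2 * ε - 1 ≤ δ * (a + 1 / (μ * n)) + 2 * ε - 1 := by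
      have : δ * a ≤ δ * (a + 1 / (μ * n)) := by gcongr; linarith
      linarith
    obtain ⟨x, hx, hx0⟩ := exists_jacobiP_zero n α β (M := Real.pi * μ * n / δ) (by positivity) hle
      (hQ _ (Set.left_mem_Icc.2 hle)).1 (hQ _ (Set.right_mem_Icc.2 hle)).2.1
      (fun x hx => (hQ x hx).2.2) (le_of_eq (by field_simp; ring))
    refine ⟨_, (hb x hx).1, ?_⟩
    rw [rescaledZeros, Set.mem_ofPred_eq, ← (hb x hx).2]
    exact hx0

theorem stmt1 (α β δ ε : ℕ → ℝ) (a1 a2 b1 b2 : ℝ)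
    (hα : ∀ n, α n > -1) (hβ : ∀ n, β n > -1) (hδ : ∀ n, δ n > 0)
    (hb1 : b1 > 0) (hb2 : b2 > 0)
    (h1 : Tendsto (fun n : ℕ =>
        (1 / δ n) * (((n : ℝ) + β n) / (2 * (n : ℝ) + α n + β n) - ε n))
      atTop (𝓝 (a1 / 2)))
    (h2 : Tendsto (fun n : ℕ =>
        (1 / δ n) * (((n : ℝ) * ((n : ℝ) + α n) + ((n : ℝ) + β n) * ((n : ℝ) + α n + β n)) /
          (2 * (n : ℝ) + α n + β n) ^ 2 - ε n))
      atTop (𝓝 (a2 / 2)))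
    (h3 : Tendsto (fun n : ℕ =>
        (1 / (δ n) ^ 2) * (((n : ℝ) + β n) * ((n : ℝ) + α n) * (n : ℝ) /
          (2 * (n : ℝ) + α n + β n) ^ 3))
      atTop (𝓝 (b1 / 4)))
    (h4 : Tendsto (fun n : ℕ =>
        (1 / (δ n) ^ 2) * (((n : ℝ) + β n) * ((n : ℝ) + α n) * ((n : ℝ) + α n + β n) * (n : ℝ) /
          (2 * (n : ℝ) + α n + β n) ^ 4))
      atTop (𝓝 (b2 / 4)))
    (f : ℝ → ℝ)
    (hf : ∀ x, f x = if |x - a2| ≤ 2 * Real.sqrt b2 then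
        (b1 / (2 * Real.pi)) * Real.sqrt (4 * b2 - (x - a2) ^ 2) /
          ((b2 - b1) * x ^ 2 + (b1 * a2 + b1 * a1 - 2 * b2 * a1) * x +
            b2 * a1 ^ 2 - a1 * a2 * b1 + b1 ^ 2)
      else 0)
    (ξ : ℝ) :
    Tendsto (fun n : ℕ => (jacobiN n (α n) (β n) (δ n * ξ + 2 * ε n - 1) : ℝ) / n)
      atTop (𝓝 (∫ x in (a2 - 2 * Real.sqrt b2)..ξ, f x)) := by
  have hA₁ : Tendsto (fun n : ℕ => jacobiA₁ n (α n) (β n) (δ n) (ε n)) atTop (𝓝 a1) := by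
    simpa only [jacobiA₁, mul_div_cancel₀ a1 (two_ne_zero' ℝ)] using h1.const_mul 2
  have hA₂ : Tendsto (fun n : ℕ => jacobiA₂ n (α n) (β n) (δ n) (ε n)) atTop (𝓝 a2) := by
    simpa only [jacobiA₂, mul_div_cancel₀ a2 (two_ne_zero' ℝ)] using h2.const_mul 2
  have hB₁ : Tendsto (fun n : ℕ => jacobiB₁ n (α n) (β n) (δ n)) atTop (𝓝 b1) := by
    simpa only [jacobiB₁, mul_div_cancel₀ b1 (four_ne_zero' ℝ)] using h3.const_mul 4
  have hB₂ : Tendsto (fun n : ℕ => jacobiB₂ n (α n) (β n) (δ n)) atTop (𝓝 b2) := by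
    simpa only [jacobiB₂, mul_div_cancel₀ b2 (four_ne_zero' ℝ)] using h4.const_mul 4
  obtain ⟨h12, h21, hd⟩ := jacobi_limit_constraints hα hβ hδ hA₁ hA₂ hB₁ hB₂
  have hs : 0 < √b2 := Real.sqrt_pos.2 hb2
  have hf1 : ∀ x, |x - a2| ≤ 2 * √b2 → f x = (b1 / (2 * Real.pi)) * √(4 * b2 - (x - a2) ^ 2) /
      densityDenom a1 a2 b1 b2 x := fun x hx => by rw [hf, if_pos hx, densityDenom]
  have hf2 : ∀ x ∈ Set.Ioo (a2 - 2 * √b2) (a2 + 2 * √b2), f x =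
      (b1 / (2 * Real.pi)) * √(4 * b2 - (x - a2) ^ 2) / densityDenom a1 a2 b1 b2 x :=
    fun x hx => hf1 x (abs_le.2 ⟨by linarith [hx.1], by linarith [hx.2]⟩)
  have hD : ∀ x ∈ Set.Ioo (a2 - 2 * √b2) (a2 + 2 * √b2), 0 < densityDenom a1 a2 b1 b2 x :=
    fun x hx => densityDenom_pos hb2 h12 h21 hd hx.1 hx.2
  obtain ⟨hint, hone⟩ := density_integral hb2 h12 h21 hd hf1
  have hcont : ContinuousOn f (Set.Ioo (a2 - 2 * √b2) (a2 + 2 * √b2)) := by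
    refine ContinuousOn.congr (ContinuousOn.div (Continuous.continuousOn (by fun_prop))
      (Continuous.continuousOn ?_) fun x hx => (hD x hx).ne') hf2
    unfold densityDenom
    fun_prop
  have hzero : ∀ x, x ∉ Set.Icc (a2 - 2 * √b2) (a2 + 2 * √b2) → f x = 0 := fun x hx => by
    rw [hf, if_neg fun h => hx ?_]
    obtain ⟨h1, h2⟩ := abs_le.1 h
    exact ⟨by linarith, by linarith⟩
  have h := tendsto_count_of_local_lower_bound
    (Z := fun n => rescaledZeros n (α n) (β n) (δ n) (ε n))
    (fun n => rescaledZeros_finite n (β n) (ε n) (hα n) (hδ n))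
    (fun n => ncard_rescaledZeros_le n (β n) (ε n) (hα n) (hδ n)) (by linarith) hcont hint hone
    hzero ?_ ξ
  · simpa only [jacobiN_eq_ncard_rescaledZeros _ _ _ _ _ (hδ _)] using h
  · intro c d μ hc hcd hd hμf
    rcases le_or_gt μ 0 with hμ | hμ
    · refine Eventually.of_forall fun n => ?_
      have h1 : (n : ℝ) * (d - c) * μ ≤ 0 :=
        mul_nonpos_of_nonneg_of_nonpos (mul_nonneg n.cast_nonneg (sub_pos.2 hcd).le) hμ
      have h2 : (0 : ℝ) ≤ ((rescaledZeros n (α n) (β n) (δ n) (ε n) ∩ Set.Ioc c d).ncard : ℝ) :=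
        Nat.cast_nonneg _
      linarith
    · have hIoo : ∀ t ∈ Set.Icc c d, t ∈ Set.Ioo (a2 - 2 * √b2) (a2 + 2 * √b2) := fun t ht =>
        ⟨hc.trans_le ht.1, ht.2.trans_lt hd⟩
      filter_upwards [eventually_jacobi_density_lt hA₁ hA₂ hB₁ hB₂ fun t ht =>
          ⟨hD t (hIoo t ht), sq_mul_lt_of_lt_div hμ (hD t (hIoo t ht))
            (hf2 t (hIoo t ht) ▸ hμf t ht)⟩,
        tendsto_natCast_atTop_atTop.eventually_ge_atTop (2 : ℝ)] with n hn hn2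
      exact le_ncard_rescaledZeros hn2 (hα n) (hβ n) (hδ n) hcd hμ hn
end

section
/- Let (α_n) and (β_n) be sequences with α_n, β_n > −1 such that α_n/n → a and β_n/n → b as n → ∞, where a, b ≥ 0. Set r_{1,2} = (b² − a² ∓ 4√((a+1)(b+1)(a+b+1)))/(2+a+b)² (so r_1 ≤ r_2). Then for every ξ with r_1 ≤ ξ ≤ r_2, lim_{n→∞} (1/n)·N^{(α_n,β_n)}(ξ) = ((2+a+b)/(2π)) · ∫_{r_1}^{ξ} √((r_2−x)(x−r_1))/(1−x²) dx. -/
open Filter Topology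

/-- Sturm comparison with a constant coefficient: a solution of `u'' + q u = 0` with `m ^ 2 ≤ q`
vanishes somewhere on every half-open interval of length `π / m`. -/
theorem exists_zero_of_sq_le {u u' q : ℝ → ℝ} {c m : ℝ} (hm : 0 < m)
    (hu : ∀ x ∈ Set.Icc c (c + Real.pi / m), HasDerivAt u (u' x) x)
    (hu' : ∀ x ∈ Set.Icc c (c + Real.pi / m), HasDerivAt u' (-(q x) * u x) x)
    (hq : ∀ x ∈ Set.Icc c (c + Real.pi / m), m ^ 2 ≤ q x) :
    ∃ x ∈ Set.Ioc c (c + Real.pi / m), u x = 0 := by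
  have key : ∀ v v' : ℝ → ℝ, (∀ x ∈ Set.Icc c (c + Real.pi / m), HasDerivAt v (v' x) x) →
      (∀ x ∈ Set.Icc c (c + Real.pi / m), HasDerivAt v' (-(q x) * v x) x) →
      ¬ ∀ x ∈ Set.Ioc c (c + Real.pi / m), 0 < v x := by
    intro v v' hv hv' hpos
    have hlt : c < c + Real.pi / m := by have := Real.pi_pos; linarith [div_pos this hm]
    have hc0 : 0 ≤ v c := by
      have hcont : ContinuousWithinAt v (Set.Ioi c) c :=
        (hv c ⟨le_rfl, hlt.le⟩).continuousAt.continuousWithinAt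
      refine ge_of_tendsto hcont ?_
      filter_upwards [Ioc_mem_nhdsGT hlt] with x hx using (hpos x hx).le
    have hnn : ∀ x ∈ Set.Icc c (c + Real.pi / m), 0 ≤ v x := by
      intro x hx
      rcases eq_or_lt_of_le hx.1 with h | h
      · exact h ▸ hc0
      · exact (hpos x ⟨h, hx.2⟩).le
    have hW : ∀ x ∈ Set.Icc c (c + Real.pi / m),
        HasDerivAt (fun x => v' x * Real.sin (m * (x - c)) - v x * (m * Real.cos (m * (x - c))))
          ((m ^ 2 - q x) * v x * Real.sin (m * (x - c))) x := by
      intro x hx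
      have hl : HasDerivAt (fun x : ℝ => m * (x - c)) m x := by
        simpa using ((hasDerivAt_id x).sub_const c).const_mul m
      have h := ((hv' x hx).mul hl.sin).sub ((hv x hx).mul (hl.cos.const_mul m))
      refine h.congr_deriv ?_
      ring
    have hanti : AntitoneOn
        (fun x => v' x * Real.sin (m * (x - c)) - v x * (m * Real.cos (m * (x - c))))
        (Set.Icc c (c + Real.pi / m)) := by
      refine antitoneOn_of_hasDerivWithinAt_nonpos (convex_Icc _ _)
        (fun x hx => (hW x hx).continuousAt.continuousWithinAt)
        (fun x hx => (hW x (interior_subset hx)).hasDerivWithinAt) ?_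
      intro x hx
      have hx' := interior_subset hx
      have h1 : m * (x - c) ≤ Real.pi := by
        have : x - c ≤ Real.pi / m := by linarith [hx'.2]
        rw [le_div_iff₀ hm] at this
        linarith
      have hs : 0 ≤ Real.sin (m * (x - c)) :=
        Real.sin_nonneg_of_nonneg_of_le_pi (mul_nonneg hm.le (by linarith [hx'.1])) h1
      exact mul_nonpos_of_nonpos_of_nonneg
        (mul_nonpos_of_nonpos_of_nonneg (by linarith [hq x hx']) (hnn x hx')) hs
    have h := hanti ⟨le_rfl, hlt.le⟩ ⟨hlt.le, le_rfl⟩ hlt.le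
    have e : m * (c + Real.pi / m - c) = Real.pi := by field_simp; ring
    simp only [e, sub_self, mul_zero, Real.sin_zero, Real.cos_zero, Real.sin_pi,
      Real.cos_pi] at h
    have h2 := mul_pos (hpos _ ⟨hlt, le_rfl⟩) hm
    have h3 := mul_nonneg hc0 hm.le
    linarith
  by_contra! hne
  have hcont : ContinuousOn u (Set.Ioc c (c + Real.pi / m)) := fun x hx =>
    (hu x ⟨hx.1.le, hx.2⟩).continuousAt.continuousWithinAt
  by_cases hp : ∀ x ∈ Set.Ioc c (c + Real.pi / m), 0 < u x
  · exact key u u' hu hu' hp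
  push Not at hp
  obtain ⟨x₀, hx₀, hle⟩ := hp
  refine key (fun x => -u x) (fun x => -u' x) (fun x hx => (hu x hx).neg)
    (fun x hx => ((hu' x hx).neg).congr_deriv (by ring)) fun x hx => ?_
  by_contra! hx0
  obtain ⟨z, hz, hz0⟩ := isPreconnected_Ioc.intermediate_value hx₀ hx hcont
    (show (0 : ℝ) ∈ Set.Icc (u x₀) (u x) from ⟨hle, by linarith⟩)
  exact hne z hz hz0

theorem genBinom_succ (t : ℝ) (m : ℕ) :
    genBinom t (m + 1) * (m + 1) = genBinom t m * (t - m) := by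
  unfold genBinom
  rw [Finset.prod_range_succ, Nat.factorial_succ]
  have : (Nat.factorial m : ℝ) ≠ 0 := by positivity
  have h2 : (m : ℝ) + 1 ≠ 0 := by positivity
  push_cast
  field_simp

/-- The `j`-th moment of the terms of the Jacobi polynomial, weighted by their index. -/
noncomputable def jacobiMoment (n : ℕ) (α β : ℝ) (j : ℕ) (x : ℝ) : ℝ :=
  ∑ k ∈ Finset.range (n + 1),
    genBinom ((n : ℝ) + α) (n - k) * genBinom ((n : ℝ) + β) k * (k : ℝ) ^ j *
      (((x - 1) / 2) ^ k * ((x + 1) / 2) ^ (n - k))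

theorem jacobiMoment_zero (n : ℕ) (α β x : ℝ) : jacobiMoment n α β 0 x = jacobiP n α β x := by
  simp [jacobiMoment, jacobiP, mul_assoc]

theorem hasDerivAt_jacobiMoment (n : ℕ) (α β : ℝ) (j : ℕ) {x : ℝ} (h1 : x ≠ 1) (h2 : x ≠ -1) :
    HasDerivAt (jacobiMoment n α β j)
      (jacobiMoment n α β (j + 1) x / (x - 1) +
        (n * jacobiMoment n α β j x - jacobiMoment n α β (j + 1) x) / (x + 1)) x := by
  have hs : x - 1 ≠ 0 := sub_ne_zero.mpr h1
  have ht : x + 1 ≠ 0 := fun h => h2 (by linarith)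
  have hpow : ∀ (k : ℕ) (f : ℝ → ℝ), HasDerivAt f (1 / 2) x → f x ≠ 0 →
      HasDerivAt (fun y => f y ^ k) (k / (2 * f x) * f x ^ k) x := by
    intro k f hf h0
    refine (hf.pow k).congr_deriv ?_
    rcases k with _ | k
    · simp
    · simp only [Nat.add_sub_cancel, pow_succ]
      field_simp
  have hS : HasDerivAt (fun y : ℝ => (y - 1) / 2) (1 / 2) x :=
    ((hasDerivAt_id x).sub_const 1).div_const 2
  have hT : HasDerivAt (fun y : ℝ => (y + 1) / 2) (1 / 2) x :=
    ((hasDerivAt_id x).add_const 1).div_const 2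
  unfold jacobiMoment
  refine (HasDerivAt.fun_sum fun k _ => (((hpow k _ hS (by positivity)).mul
    (hpow (n - k) _ hT (by positivity))).const_mul _)).congr_deriv ?_
  rw [Finset.mul_sum, ← Finset.sum_sub_distrib, Finset.sum_div, Finset.sum_div,
    ← Finset.sum_add_distrib]
  refine Finset.sum_congr rfl fun k hk => ?_
  have hkn : k ≤ n := Nat.lt_succ_iff.mp (Finset.mem_range.mp hk)
  rw [Nat.cast_sub hkn]
  field_simp
  ring

theorem jacobiMoment_relation (n : ℕ) (α β x : ℝ) :
    (x + 1) * (jacobiMoment n α β 2 x + α * jacobiMoment n α β 1 x) =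
      (x - 1) * (n * (n + β) * jacobiMoment n α β 0 x - (2 * n + β) * jacobiMoment n α β 1 x +
        jacobiMoment n α β 2 x) := by
  have hL : (x + 1) * (jacobiMoment n α β 2 x + α * jacobiMoment n α β 1 x) =
      ∑ k ∈ Finset.range (n + 1), genBinom ((n : ℝ) + α) (n - k) * genBinom ((n : ℝ) + β) k *
        (k * (k + α)) * ((x + 1) * (((x - 1) / 2) ^ k * ((x + 1) / 2) ^ (n - k))) := by
    unfold jacobiMoment
    rw [Finset.mul_sum, ← Finset.sum_add_distrib, Finset.mul_sum]
    exact Finset.sum_congr rfl fun k _ => by ring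
  have hR : (x - 1) * (n * (n + β) * jacobiMoment n α β 0 x -
      (2 * n + β) * jacobiMoment n α β 1 x + jacobiMoment n α β 2 x) =
      ∑ k ∈ Finset.range (n + 1), genBinom ((n : ℝ) + α) (n - k) * genBinom ((n : ℝ) + β) k *
        ((n - k) * (n - k + β)) *
          ((x - 1) * (((x - 1) / 2) ^ k * ((x + 1) / 2) ^ (n - k))) := by
    unfold jacobiMoment
    rw [Finset.mul_sum, Finset.mul_sum, ← Finset.sum_sub_distrib, ← Finset.sum_add_distrib,
      Finset.mul_sum]
    exact Finset.sum_congr rfl fun k _ => by ring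
  rw [hL, hR, Finset.sum_range_succ', Finset.sum_range_succ _ n]
  simp only [Nat.cast_zero, zero_mul, mul_zero, add_zero, sub_self]
  refine Finset.sum_congr rfl fun k hk => ?_
  obtain ⟨m, rfl⟩ : ∃ m, n = k + m + 1 := ⟨n - k - 1, by have := Finset.mem_range.mp hk; omega⟩
  have e1 : k + m + 1 - (k + 1) = m := by omega
  have e2 : k + m + 1 - k = m + 1 := by omega
  rw [e1, e2]
  have g1 := genBinom_succ (((k + m + 1 : ℕ) : ℝ) + α) m
  have g2 := genBinom_succ (((k + m + 1 : ℕ) : ℝ) + β) k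
  push_cast at g1 g2 ⊢
  have hc : genBinom ((k : ℝ) + m + 1 + α) m * genBinom ((k : ℝ) + m + 1 + β) (k + 1) *
      ((k + 1) * (k + 1 + α)) = genBinom ((k : ℝ) + m + 1 + α) (m + 1) *
      genBinom ((k : ℝ) + m + 1 + β) k * ((m + 1) * (m + 1 + β)) := by
    linear_combination (genBinom ((k : ℝ) + m + 1 + α) m * (k + 1 + α)) * g2 -
      (genBinom ((k : ℝ) + m + 1 + β) k * (m + 1 + β)) * g1
  linear_combination ((x - 1) * ((x + 1)) / 2 * ((x - 1) / 2) ^ k * ((x + 1) / 2) ^ m) * hc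

/-- The coefficient in the normal form `u'' + q u = 0` of the Jacobi differential equation. -/
noncomputable def jacobiPotential (n α β x : ℝ) : ℝ :=
  (1 - α ^ 2) / (4 * (1 - x) ^ 2) + (1 - β ^ 2) / (4 * (1 + x) ^ 2) +
    (n * (n + α + β + 1) + (α + 1) * (β + 1) / 2) / (1 - x ^ 2)

theorem exists_jacobi_normal_form (n : ℕ) (α β : ℝ) :
    ∃ p u' : ℝ → ℝ, (∀ x, 0 < p x) ∧ ∀ x, -1 < x → x < 1 →
      HasDerivAt (fun y => p y * jacobiP n α β y) (u' x) x ∧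
      HasDerivAt u' (-(jacobiPotential n α β x) * (p x * jacobiP n α β x)) x := by
  let p : ℝ → ℝ := fun x =>
    Real.exp ((α + 1) / 2 * Real.log (1 - x) + (β + 1) / 2 * Real.log (1 + x))
  let g : ℝ → ℝ := fun x => -((α + 1) / 2) / (1 - x) + (β + 1) / 2 / (1 + x)
  let S := jacobiMoment n α β
  let y' : ℝ → ℝ := fun x => S 1 x / (x - 1) + (n * S 0 x - S 1 x) / (x + 1)
  refine ⟨p, fun x => p x * (y' x + g x * S 0 x), fun x => Real.exp_pos _, fun x h1 h2 => ?_⟩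
  have n1 : x - 1 ≠ 0 := by linarith
  have n2 : x + 1 ≠ 0 := by linarith
  have n3 : 1 - x ≠ 0 := by linarith
  have n4 : 1 + x ≠ 0 := by linarith
  have d1 : HasDerivAt (fun x : ℝ => 1 - x) (-1) x := (hasDerivAt_id x).const_sub 1
  have d2 : HasDerivAt (fun x : ℝ => 1 + x) 1 x := (hasDerivAt_id x).const_add 1
  have d3 : HasDerivAt (fun x : ℝ => x - 1) 1 x := (hasDerivAt_id x).sub_const 1
  have d4 : HasDerivAt (fun x : ℝ => x + 1) 1 x := (hasDerivAt_id x).add_const 1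
  have hp : HasDerivAt p (p x * g x) x := by
    refine (((d1.log n3).const_mul ((α + 1) / 2)).add
      ((d2.log n4).const_mul ((β + 1) / 2))).exp.congr_deriv ?_
    simp only [p, g, Pi.add_apply]
    ring
  have hS : ∀ j, HasDerivAt (S j) (S (j + 1) x / (x - 1) + (n * S j x - S (j + 1) x) / (x + 1)) x :=
    fun j => hasDerivAt_jacobiMoment n α β j (by linarith) (by linarith)
  have hP : (fun y => p y * jacobiP n α β y) = fun y => p y * S 0 y := by
    funext y; simp only [S, jacobiMoment_zero]
  have hrel : (x + 1) * (S 2 x + α * S 1 x) =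
      (x - 1) * (n * (n + β) * S 0 x - (2 * n + β) * S 1 x + S 2 x) :=
    jacobiMoment_relation n α β x
  rw [hP, ← jacobiMoment_zero]
  refine ⟨(hp.mul (hS 0)).congr_deriv (by simp only [y']; ring), ?_⟩
  have hy' := ((hS 1).div d3 n1).add ((((hS 0).const_mul (n : ℝ)).sub (hS 1)).div d4 n2)
  have hg : HasDerivAt g _ x :=
    ((hasDerivAt_const x (-((α + 1) / 2))).div d1 n3).add
      ((hasDerivAt_const x ((β + 1) / 2)).div d2 n4)
  refine (hp.mul (hy'.add (hg.mul (hS 0)))).congr_deriv ?_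
  have e3 : 1 - x = -(x - 1) := by ring
  have e4 : 1 + x = x + 1 := by ring
  have e5 : 1 - x ^ 2 = -(x - 1) * (x + 1) := by ring
  change _ = -(jacobiPotential n α β x) * (p x * S 0 x)
  simp only [jacobiPotential, g, e3, e4, e5, Pi.add_apply, Pi.sub_apply, Pi.mul_apply,
    Pi.div_apply, zero_add, one_add_one_eq_two]
  rw [← sub_eq_zero]
  generalize S 0 x = s0 at *
  generalize S 1 x = s1 at *
  generalize S 2 x = s2 at *
  field_simp
  linear_combination 32 * p x * hrel

theorem genBinom_pos_of_lt {t : ℝ} {m : ℕ} (h : (m : ℝ) - 1 < t) : 0 < genBinom t m := by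
  refine div_pos (Finset.prod_pos fun i hi => ?_) (by positivity)
  have : ((i + 1 : ℕ) : ℝ) ≤ m := Nat.cast_le.mpr (Finset.mem_range.mp hi)
  push_cast at this
  linarith

theorem exists_polynomial_eval_eq_jacobiP (n : ℕ) {α : ℝ} (hα : -1 < α) (β : ℝ) :
    ∃ P : Polynomial ℝ, P ≠ 0 ∧ P.natDegree ≤ n ∧ ∀ x, P.eval x = jacobiP n α β x := by
  let P : Polynomial ℝ := ∑ k ∈ Finset.range (n + 1),
    Polynomial.C (genBinom ((n : ℝ) + α) (n - k) * genBinom ((n : ℝ) + β) k *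
      (1 / 2) ^ k * (1 / 2) ^ (n - k)) *
      ((Polynomial.X - Polynomial.C 1) ^ k * (Polynomial.X - Polynomial.C (-1)) ^ (n - k))
  have hP : ∀ x, P.eval x = jacobiP n α β x := by
    intro x
    simp only [P, jacobiP, Polynomial.eval_finsetSum]
    refine Finset.sum_congr rfl fun k _ => ?_
    simp only [Polynomial.eval_mul, Polynomial.eval_C, Polynomial.eval_pow, Polynomial.eval_sub,
      Polynomial.eval_X, div_pow, one_pow, sub_neg_eq_add]
    ring
  refine ⟨P, ?_, ?_, hP⟩
  · intro h
    have h1 := hP 1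
    rw [h, Polynomial.eval_zero, jacobiP, Finset.sum_eq_single 0] at h1
    · have : 0 < genBinom ((n : ℝ) + α) n := genBinom_pos_of_lt (by linarith)
      simp [genBinom] at h1 this
      linarith
    · intro k _ hk
      simp [hk]
    · simp
  · refine Polynomial.natDegree_sum_le_of_forall_le _ _ fun k hk => ?_
    have hkn : k ≤ n := Nat.lt_succ_iff.mp (Finset.mem_range.mp hk)
    refine (Polynomial.natDegree_C_mul_le _ _).trans (Polynomial.natDegree_mul_le.trans ?_)
    rw [Polynomial.natDegree_pow, Polynomial.natDegree_pow, Polynomial.natDegree_X_sub_C,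
      Polynomial.natDegree_X_sub_C]
    omega

theorem jacobi_zeros_finite (n : ℕ) {α : ℝ} (hα : -1 < α) (β : ℝ) :
    {x | jacobiP n α β x = 0}.Finite ∧ {x | jacobiP n α β x = 0}.ncard ≤ n := by
  obtain ⟨P, hP0, hdeg, hP⟩ := exists_polynomial_eval_eq_jacobiP n hα β
  have he : {x | jacobiP n α β x = 0} = (P.roots.toFinset : Set ℝ) := by
    ext x
    simp [hP0, hP]
  rw [he, Set.ncard_coe_finset]
  exact ⟨Finset.finite_toSet _,
    (Multiset.toFinset_card_le _).trans ((Polynomial.card_roots' P).trans hdeg)⟩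

theorem jacobiN_le (n : ℕ) {α : ℝ} (hα : -1 < α) (β ξ : ℝ) : jacobiN n α β ξ ≤ n :=
  (Set.ncard_le_ncard (fun _ hx => hx.1) (jacobi_zeros_finite n hα β).1).trans
    (jacobi_zeros_finite n hα β).2

theorem jacobiN_mono (n : ℕ) {α : ℝ} (hα : -1 < α) (β : ℝ) : Monotone (jacobiN n α β) :=
  fun _ _ h => Set.ncard_le_ncard (fun _ hx => ⟨hx.1, hx.2.trans h⟩)
    ((jacobi_zeros_finite n hα β).1.subset fun _ hx => hx.1)

theorem jacobiN_lt_of_zero (n : ℕ) {α : ℝ} (hα : -1 < α) (β : ℝ) {c d x : ℝ}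
    (hx : x ∈ Set.Ioc c d) (h0 : jacobiP n α β x = 0) : jacobiN n α β c < jacobiN n α β d := by
  refine Set.ncard_lt_ncard ⟨fun y hy => ⟨hy.1, hy.2.trans (hx.1.le.trans hx.2)⟩, fun h => ?_⟩
    ((jacobi_zeros_finite n hα β).1.subset fun _ hx => hx.1)
  exact absurd (h ⟨h0, hx.2⟩).2 (not_le.mpr hx.1)

theorem jacobiN_add_le (n : ℕ) {α : ℝ} (hα : -1 < α) (β : ℝ) {c d m : ℝ} (hm : 0 < m)
    (hc : -1 < c) (hd : d < 1) (hq : ∀ x ∈ Set.Icc c d, m ^ 2 ≤ jacobiPotential n α β x)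
    (k : ℕ) (hk : c + k * (Real.pi / m) ≤ d) :
    jacobiN n α β c + k ≤ jacobiN n α β (c + k * (Real.pi / m)) := by
  induction k with
  | zero => simp
  | succ k ih =>
    have hpm : 0 < Real.pi / m := div_pos Real.pi_pos hm
    have e : c + (k + 1 : ℕ) * (Real.pi / m) = c + k * (Real.pi / m) + Real.pi / m := by
      push_cast; ring
    rw [e] at hk ⊢
    have hck : c ≤ c + k * (Real.pi / m) := by
      have : 0 ≤ k * (Real.pi / m) := by positivity
      linarith
    obtain ⟨p, u', hp, hu⟩ := exists_jacobi_normal_form n α β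
    obtain ⟨x, hx, hx0⟩ := exists_zero_of_sq_le (q := jacobiPotential n α β) hm
      (fun x hx => (hu x (by linarith [hx.1]) (by linarith [hx.2])).1)
      (fun x hx => (hu x (by linarith [hx.1]) (by linarith [hx.2])).2)
      (fun x hx => hq x ⟨hck.trans hx.1, hx.2.trans hk⟩)
    have h1 := jacobiN_lt_of_zero n hα β hx ((mul_eq_zero.mp hx0).resolve_left (hp x).ne')
    have h2 := ih (by linarith)
    omega

/-- The Jacobi potential divided by `n ^ 2`, in terms of `A = α / n`, `B = β / n`, `s = 1 / n`. -/
noncomputable def scaledPotential (A B s x : ℝ) : ℝ :=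
  (s ^ 2 - A ^ 2) / (4 * (1 - x) ^ 2) + (s ^ 2 - B ^ 2) / (4 * (1 + x) ^ 2) +
    (1 + A + B + s + (A + s) * (B + s) / 2) / (1 - x ^ 2)

theorem jacobiPotential_eq {n : ℝ} (hn : n ≠ 0) (α β x : ℝ) :
    jacobiPotential n α β x = n ^ 2 * scaledPotential (α / n) (β / n) (1 / n) x := by
  unfold jacobiPotential scaledPotential
  rw [mul_add (n ^ 2), mul_add (n ^ 2), ← mul_div_assoc, ← mul_div_assoc, ← mul_div_assoc]
  congr 2
  · congr 1; field_simp
  · congr 1; field_simp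
  · field_simp

theorem jacobiN_local_lower_bound {α β : ℕ → ℝ} {a b : ℝ} (hα : ∀ n, α n > -1)
    (hαlim : Tendsto (fun n : ℕ => α n / n) atTop (𝓝 a))
    (hβlim : Tendsto (fun n : ℕ => β n / n) atTop (𝓝 b))
    {x₀ μ : ℝ} (h1 : -1 < x₀) (h2 : x₀ < 1) (hμ : 0 < μ)
    (hlt : (Real.pi * μ) ^ 2 < scaledPotential a b 0 x₀) :
    ∃ δ > 0, ∀ c d, c ≤ d → Set.Icc c d ⊆ Metric.ball x₀ δ →
      ∀ᶠ n : ℕ in atTop,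
        (jacobiN n (α n) (β n) c : ℝ) + n * (d - c) * μ - 1 ≤ jacobiN n (α n) (β n) d := by
  have hcont : ContinuousAt (fun p : (ℝ × ℝ × ℝ) × ℝ => scaledPotential p.1.1 p.1.2.1 p.1.2.2 p.2)
      ((a, b, 0), x₀) := by
    have n1 : 4 * (1 - x₀) ^ 2 ≠ 0 := by
      have : 1 - x₀ ≠ 0 := by linarith
      positivity
    have n2 : 4 * (1 + x₀) ^ 2 ≠ 0 := by
      have : 1 + x₀ ≠ 0 := by linarith
      positivity
    have n3 : 1 - x₀ ^ 2 ≠ 0 := by nlinarith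
    unfold scaledPotential
    refine ((ContinuousAt.div ?_ ?_ ?_).add (ContinuousAt.div ?_ ?_ ?_)).add
      (ContinuousAt.div ?_ ?_ ?_) <;> first | fun_prop | assumption
  have hev := hcont.eventually_const_lt hlt
  rw [nhds_prod_eq, Filter.eventually_prod_iff] at hev
  obtain ⟨pa, hpa, pb, hpb, hab⟩ := hev
  obtain ⟨δ, hδ, hball⟩ := Metric.eventually_nhds_iff_ball.mp
    (hpb.and (Ioo_mem_nhds h1 h2))
  refine ⟨δ, hδ, fun c d hcd hsub => ?_⟩
  have hlim : Tendsto (fun n : ℕ => (α n / n, β n / n, 1 / (n : ℝ))) atTop (𝓝 (a, b, 0)) :=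
    hαlim.prodMk_nhds (hβlim.prodMk_nhds tendsto_one_div_atTop_nhds_zero_nat)
  filter_upwards [hlim.eventually hpa, eventually_gt_atTop 0] with n hn hn0
  have hn0' : (0 : ℝ) < n := Nat.cast_pos.mpr hn0
  have hm : 0 < n * (Real.pi * μ) := by have := Real.pi_pos; positivity
  have hq : ∀ x ∈ Set.Icc c d, (n * (Real.pi * μ)) ^ 2 ≤ jacobiPotential n (α n) (β n) x := by
    intro x hx
    rw [jacobiPotential_eq hn0'.ne', mul_pow]
    exact mul_le_mul_of_nonneg_left (hab hn (hball x (hsub hx)).1).le (by positivity)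
  have e : Real.pi / (n * (Real.pi * μ)) = 1 / (n * μ) := by
    have := Real.pi_pos
    field_simp
  have hnn : 0 ≤ n * (d - c) * μ := by
    have := sub_nonneg.mpr hcd
    positivity
  have hk : c + (⌊n * (d - c) * μ⌋₊ : ℕ) * (Real.pi / (n * (Real.pi * μ))) ≤ d := by
    have := Nat.floor_le hnn
    rw [e, mul_one_div]
    have h3 : (⌊n * (d - c) * μ⌋₊ : ℝ) / (n * μ) ≤ d - c := by
      rw [div_le_iff₀ (by positivity)]
      linarith
    linarith
  have h := jacobiN_add_le n (hα n) (β n) hm (hball c (hsub ⟨le_rfl, hcd⟩)).2.1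
    (hball d (hsub ⟨hcd, le_rfl⟩)).2.2 hq _ hk
  have h' : ((jacobiN n (α n) (β n) c + ⌊n * (d - c) * μ⌋₊ : ℕ) : ℝ) ≤ jacobiN n (α n) (β n) d :=
    Nat.cast_le.mpr (h.trans (jacobiN_mono n (hα n) (β n) hk))
  push_cast at h'
  linarith [Nat.lt_floor_add_one (n * (d - c) * μ)]

/-- Local lower bounds for the increments of monotone counting functions, with density `f`,
integrate to a lower bound for the increment over a compact interval. -/
theorem eventually_increment_ge_of_local {N : ℕ → ℝ → ℝ} (hN : ∀ n, Monotone (N n))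
    {G f : ℝ → ℝ} {c d : ℝ} (hcd : c ≤ d) (hG : ∀ x ∈ Set.Icc c d, HasDerivAt G (f x) x)
    (hf : ContinuousOn f (Set.Icc c d))
    (hloc : ∀ x₀ ∈ Set.Icc c d, ∀ μ, 0 < μ → μ < f x₀ → ∃ δ > 0, ∀ c' d', c' ≤ d' →
      Set.Icc c' d' ⊆ Metric.ball x₀ δ →
        ∀ᶠ n : ℕ in atTop, N n c' + n * (d' - c') * μ - 1 ≤ N n d')
    {ε : ℝ} (hε : 0 < ε) :
    ∀ᶠ n : ℕ in atTop, N n c + n * (G d - G c - ε * (d - c)) ≤ N n d := by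
  have hδ : ∀ x₀ : Set.Icc c d, ∃ δ > 0, ∀ c' ∈ Set.Icc c d, ∀ d' ∈ Set.Icc c d, c' ≤ d' →
      Set.Icc c' d' ⊆ Metric.ball (x₀ : ℝ) δ →
        ∀ᶠ n : ℕ in atTop, N n c' + n * (G d' - G c' - ε * (d' - c')) ≤ N n d' := by
    rintro ⟨x₀, hx₀⟩
    obtain ⟨δ₁, hδ₁, hf₁⟩ := Metric.continuousOn_iff.mp hf x₀ hx₀ (ε / 3) (by positivity)
    have hGle : ∀ c' ∈ Set.Icc c d, ∀ d' ∈ Set.Icc c d, c' < d' →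
        Set.Icc c' d' ⊆ Metric.ball x₀ δ₁ → G d' - G c' ≤ (f x₀ + ε / 3) * (d' - c') := by
      intro c' hc' d' hd' hlt hsub
      have hin : Set.Icc c' d' ⊆ Set.Icc c d := Set.Icc_subset_Icc hc'.1 hd'.2
      obtain ⟨y, hy, hyeq⟩ := exists_hasDerivAt_eq_slope G f hlt
        (fun x hx => (hG x (hin hx)).continuousAt.continuousWithinAt)
        (fun x hx => hG x (hin (Set.Ioo_subset_Icc_self hx)))
      have hy' := Set.Ioo_subset_Icc_self hy
      have h := hf₁ y (hin hy') (hsub hy')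
      rw [Real.dist_eq, abs_lt] at h
      have hpos : 0 < d' - c' := by linarith
      rw [eq_div_iff hpos.ne'] at hyeq
      rw [← hyeq]
      exact mul_le_mul_of_nonneg_right (by linarith) hpos.le
    rcases le_or_gt (f x₀ - ε / 3) 0 with hμ | hμ
    · refine ⟨δ₁, hδ₁, fun c' hc' d' hd' hle hsub => Eventually.of_forall fun n => ?_⟩
      rcases hle.eq_or_lt with rfl | hlt
      · simp
      have h1 := hGle c' hc' d' hd' hlt hsub
      have h2 : G d' - G c' - ε * (d' - c') ≤ 0 := by nlinarith
      have h3 := mul_nonpos_of_nonneg_of_nonpos (Nat.cast_nonneg (α := ℝ) n) h2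
      linarith [hN n hle]
    · obtain ⟨δ₂, hδ₂, h₂⟩ := hloc x₀ hx₀ _ hμ (by linarith)
      refine ⟨min δ₁ δ₂, lt_min hδ₁ hδ₂, fun c' hc' d' hd' hle hsub => ?_⟩
      rcases hle.eq_or_lt with rfl | hlt
      · simp
      have h1 := hGle c' hc' d' hd' hlt
        (hsub.trans (Metric.ball_subset_ball (min_le_left _ _)))
      have hpos : 0 < d' - c' := by linarith
      have hlarge : ∀ᶠ n : ℕ in atTop, 1 / ((d' - c') * (ε / 3)) ≤ n :=
        tendsto_natCast_atTop_atTop.eventually_ge_atTop _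
      filter_upwards [h₂ c' d' hle (hsub.trans (Metric.ball_subset_ball (min_le_right _ _))),
        hlarge] with n hn hn'
      rw [div_le_iff₀ (by positivity)] at hn'
      have h3 := mul_le_mul_of_nonneg_left h1 (Nat.cast_nonneg (α := ℝ) n)
      linarith
  choose δ hδpos hδ using hδ
  obtain ⟨t, ht0, htmono, ⟨m, htm⟩, hcover⟩ := exists_monotone_Icc_subset_open_cover_Icc hcd
    (c := fun x₀ : Set.Icc c d => {y : Set.Icc c d | (y : ℝ) ∈ Metric.ball (x₀ : ℝ) (δ x₀)})
    (fun x₀ => Metric.isOpen_ball.preimage continuous_subtype_val)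
    (fun x _ => Set.mem_iUnion.mpr ⟨x, Metric.mem_ball_self (hδpos x)⟩)
  have hind : ∀ k, ∀ᶠ n : ℕ in atTop,
      N n c + n * (G (t k) - G c - ε * (t k - c)) ≤ N n (t k) := by
    intro k
    induction k with
    | zero => simp [ht0]
    | succ k ih =>
      obtain ⟨x₀, hx₀⟩ := hcover k
      have hk := hδ x₀ (t k) (t k).2 (t (k + 1)) (t (k + 1)).2 (htmono k.le_succ)
        fun y hy => hx₀ (show (⟨y, (t k).2.1.trans hy.1, hy.2.trans (t (k + 1)).2.2⟩ :
          Set.Icc c d) ∈ Set.Icc (t k) (t (k + 1)) from hy)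
      filter_upwards [ih, hk] with n h1 h2
      linarith
  have := hind m
  rwa [htm m le_rfl] at this

/-- Counting functions of total mass at most `n` whose increments on compact subintervals are
asymptotically bounded below by those of a continuous distribution function `G` of total mass `1`
converge to `G` after normalization. -/
theorem tendsto_div_of_increment_ge {N : ℕ → ℝ → ℝ} (hN : ∀ n, Monotone (N n))
    (hN0 : ∀ n x, 0 ≤ N n x) (hNn : ∀ n x, N n x ≤ n) {G : ℝ → ℝ} {r s : ℝ}
    (hG : ContinuousOn G (Set.Icc r s)) (hr : G r = 0) (hs : G s = 1)
    (hinc : ∀ c d, r < c → c < d → d < s → ∀ ε > 0,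
      ∀ᶠ n : ℕ in atTop, N n c + n * (G d - G c - ε) ≤ N n d)
    {ξ : ℝ} (hξ : ξ ∈ Set.Icc r s) :
    Tendsto (fun n : ℕ => N n ξ / n) atTop (𝓝 (G ξ)) := by
  have hext : ∀ c d, r ≤ c → c ≤ d → d ≤ s → ∀ ε > 0,
      ∀ᶠ n : ℕ in atTop, N n c + n * (G d - G c - ε) ≤ N n d := by
    intro c d hc hcd hd ε hε
    rcases hcd.eq_or_lt with rfl | hlt
    · refine Eventually.of_forall fun n => ?_
      have : 0 ≤ n * ε := by positivity
      linarith
    obtain ⟨δ₁, hδ₁, h₁⟩ := Metric.continuousOn_iff.mp hG c ⟨hc, hcd.trans hd⟩ (ε / 3) (by positivity)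
    obtain ⟨δ₂, hδ₂, h₂⟩ := Metric.continuousOn_iff.mp hG d ⟨hc.trans hcd, hd⟩ (ε / 3) (by positivity)
    obtain ⟨η, hη0, hη⟩ : ∃ η > 0, η < min (min δ₁ δ₂) ((d - c) / 2) :=
      exists_between (lt_min (lt_min hδ₁ hδ₂) (by linarith))
    obtain ⟨hη12, hη3⟩ := lt_min_iff.mp hη
    obtain ⟨hη1, hη2⟩ := lt_min_iff.mp hη12
    have g1 := h₁ (c + η) ⟨by linarith, by linarith⟩ (by
      rw [Real.dist_eq, abs_lt]; constructor <;> linarith)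
    have g2 := h₂ (d - η) ⟨by linarith, by linarith⟩ (by
      rw [Real.dist_eq, abs_lt]; constructor <;> linarith)
    rw [Real.dist_eq, abs_lt] at g1 g2
    filter_upwards [hinc (c + η) (d - η) (by linarith) (by linarith) (by linarith) (ε / 3)
      (by positivity)] with n hn
    have h3 : (n : ℝ) * (G d - G c - ε) ≤ n * (G (d - η) - G (c + η) - ε / 3) :=
      mul_le_mul_of_nonneg_left (by linarith) (Nat.cast_nonneg n)
    linarith [hN n (show c ≤ c + η by linarith), hN n (show d - η ≤ d by linarith)]
  rw [Metric.tendsto_atTop']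
  intro ε hε
  obtain ⟨M, hM⟩ := eventually_atTop.mp
    ((hext r ξ le_rfl hξ.1 hξ.2 (ε / 2) (by positivity)).and
      (hext ξ s hξ.1 hξ.2 le_rfl (ε / 2) (by positivity)))
  refine ⟨M, fun n hn => ?_⟩
  obtain ⟨h1, h2⟩ := hM n hn.le
  have hn0 : (0 : ℝ) < n := Nat.cast_pos.mpr (by omega)
  rw [hr] at h1
  rw [hs] at h2
  have h3 := hN0 n r
  have h4 := hNn n s
  have l1 : G ξ - ε / 2 ≤ N n ξ / n := by rw [le_div_iff₀ hn0]; linarith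
  have l2 : N n ξ / n ≤ G ξ + ε / 2 := by rw [div_le_iff₀ hn0]; linarith
  rw [Real.dist_eq, abs_lt]
  constructor <;> linarith

theorem hasDerivAt_arcsin_linear {M R x : ℝ} (hR : 0 < R) (h : 0 < R ^ 2 - (x - M) ^ 2) :
    HasDerivAt (fun x => Real.arcsin ((x - M) / R)) (1 / √(R ^ 2 - (x - M) ^ 2)) x := by
  have e : 1 - ((x - M) / R) ^ 2 = (R ^ 2 - (x - M) ^ 2) / R ^ 2 := by field_simp
  have hpos : 0 < 1 - ((x - M) / R) ^ 2 := by rw [e]; positivity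
  have hd : HasDerivAt (fun x : ℝ => (x - M) / R) (1 / R) x :=
    ((hasDerivAt_id x).sub_const M).div_const R
  have h1 : (x - M) / R ≠ -1 := fun h0 => by rw [h0] at hpos; norm_num at hpos
  have h2 : (x - M) / R ≠ 1 := fun h0 => by rw [h0] at hpos; norm_num at hpos
  refine ((Real.hasDerivAt_arcsin h1 h2).comp x hd).congr_deriv ?_
  rw [e, Real.sqrt_div' _ (sq_nonneg R), Real.sqrt_sq hR.le]
  have := Real.sqrt_pos.mpr h
  field_simp

/-- An antiderivative of `K / ((C - y) √(R² - y²))`, where `K = √(C² - R²)`. -/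
theorem hasDerivAt_arcsin_mobius {C K R y : ℝ} (hR : 0 < R) (hK : 0 < K)
    (hC : K ^ 2 = C ^ 2 - R ^ 2) (hy : 0 < C - y) (h : 0 < R ^ 2 - y ^ 2) :
    HasDerivAt (fun y => Real.arcsin ((C * y - R ^ 2) / (R * (C - y))))
      (K / ((C - y) * √(R ^ 2 - y ^ 2))) y := by
  have e : 1 - ((C * y - R ^ 2) / (R * (C - y))) ^ 2 =
      K ^ 2 * (R ^ 2 - y ^ 2) / (R * (C - y)) ^ 2 := by
    rw [hC]
    field_simp
    ring
  have hpos : 0 < 1 - ((C * y - R ^ 2) / (R * (C - y))) ^ 2 := by rw [e]; positivity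
  have hd : HasDerivAt (fun y : ℝ => (C * y - R ^ 2) / (R * (C - y)))
      (K ^ 2 / (R * (C - y) ^ 2)) y := by
    refine ((((hasDerivAt_id y).const_mul C).sub_const (R ^ 2)).div
      (((hasDerivAt_id y).const_sub C).const_mul R) (by positivity)).congr_deriv ?_
    rw [hC]
    simp only [id]
    field_simp
    ring
  have h1 : (C * y - R ^ 2) / (R * (C - y)) ≠ -1 := fun h0 => by
    rw [h0] at hpos; norm_num at hpos
  have h2 : (C * y - R ^ 2) / (R * (C - y)) ≠ 1 := fun h0 => by
    rw [h0] at hpos; norm_num at hpos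
  refine ((Real.hasDerivAt_arcsin h1 h2).comp y hd).congr_deriv ?_
  have hs : √(1 - ((C * y - R ^ 2) / (R * (C - y))) ^ 2) =
      K * √(R ^ 2 - y ^ 2) / (R * (C - y)) := by
    rw [e, Real.sqrt_div' _ (sq_nonneg _), Real.sqrt_sq (by positivity),
      Real.sqrt_mul (sq_nonneg K), Real.sqrt_sq hK.le]
  rw [hs]
  have := Real.sqrt_pos.mpr h
  field_simp

theorem hasDerivAt_mul_arcsin_mobius {C K R y : ℝ} (hR : 0 < R) (hK : 0 ≤ K)
    (hC : K ^ 2 = C ^ 2 - R ^ 2) (hy : 0 < C - y) (h : 0 < R ^ 2 - y ^ 2) :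
    HasDerivAt (fun y => K * Real.arcsin ((C * y - R ^ 2) / (R * (C - y))))
      (K ^ 2 / ((C - y) * √(R ^ 2 - y ^ 2))) y := by
  rcases hK.eq_or_lt with rfl | hK
  · simpa using hasDerivAt_const y (0 : ℝ)
  · exact ((hasDerivAt_arcsin_mobius hR hK hC hy h).const_mul K).congr_deriv (by ring)

theorem continuousAt_mul_arcsin_mobius {C K R y : ℝ} (hR : 0 < R) (hC0 : 0 < C) (hK : 0 ≤ K)
    (hC : K ^ 2 = C ^ 2 - R ^ 2) (hy : y ≤ R) :
    ContinuousAt (fun y => K * Real.arcsin ((C * y - R ^ 2) / (R * (C - y)))) y := by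
  rcases hK.eq_or_lt with rfl | hK
  · simpa using continuousAt_const
  · have hlt : R < C := by nlinarith
    have hne : R * (C - y) ≠ 0 := mul_ne_zero hR.ne' (by linarith)
    refine continuousAt_const.mul (Real.continuous_arcsin.continuousAt.comp ?_)
    exact ContinuousAt.div (by fun_prop) (by fun_prop) hne

theorem mul_arcsin_mobius_endpoints {C K R : ℝ} (hR : 0 < R) (hC0 : 0 < C) (hK : 0 ≤ K)
    (hC : K ^ 2 = C ^ 2 - R ^ 2) :
    K * Real.arcsin ((C * R - R ^ 2) / (R * (C - R))) = K * (Real.pi / 2) ∧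
      K * Real.arcsin ((C * (-R) - R ^ 2) / (R * (C - -R))) = -(K * (Real.pi / 2)) := by
  rcases hK.eq_or_lt with rfl | hK
  · simp
  · have hlt : R < C := by nlinarith
    have e1 : (C * R - R ^ 2) / (R * (C - R)) = 1 := by
      rw [div_eq_one_iff_eq (mul_ne_zero hR.ne' (by linarith))]
      ring
    have e2 : (C * (-R) - R ^ 2) / (R * (C - -R)) = -1 := by
      rw [div_eq_iff (mul_ne_zero hR.ne' (by linarith))]
      ring
    rw [e1, e2, Real.arcsin_one, Real.arcsin_neg_one]
    exact ⟨rfl, by ring⟩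

/-- An explicit distribution function of the limiting zero density on `[M - R, M + R]`. -/
theorem exists_primitive_density {M R A B σ : ℝ} (hR : 0 < R) (hM1 : -1 < M) (hM2 : M < 1)
    (hA0 : 0 ≤ A) (hB0 : 0 ≤ B) (hA : A ^ 2 = (1 - M) ^ 2 - R ^ 2)
    (hB : B ^ 2 = (1 + M) ^ 2 - R ^ 2) (hσ : σ * (2 - A - B) = 4) :
    ∃ G : ℝ → ℝ, ContinuousOn G (Set.Icc (M - R) (M + R)) ∧ G (M - R) = 0 ∧ G (M + R) = 1 ∧
      ∀ x ∈ Set.Ioo (M - R) (M + R), HasDerivAt G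
        (σ / (2 * Real.pi) * (√((M + R - x) * (x - (M - R))) / (1 - x ^ 2))) x := by
  have hC1 : 0 < 1 - M := by linarith
  have hC2 : 0 < 1 + M := by linarith
  obtain ⟨p1, m1⟩ := mul_arcsin_mobius_endpoints hR hC1 hA0 hA
  obtain ⟨p2, m2⟩ := mul_arcsin_mobius_endpoints hR hC2 hB0 hB
  have hR1 : R ≤ 1 - M := by nlinarith
  have hR2 : R ≤ 1 + M := by nlinarith
  refine ⟨fun x => σ / (2 * Real.pi) * (Real.arcsin ((x - M) / R) -
    1 / 2 * (A * Real.arcsin (((1 - M) * (x - M) - R ^ 2) / (R * (1 - M - (x - M))))) +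
    1 / 2 * (B * Real.arcsin (((1 + M) * (M - x) - R ^ 2) / (R * (1 + M - (M - x)))))) + 1 / 2,
    ?_, ?_, ?_, ?_⟩
  · intro x hx
    refine ContinuousAt.continuousWithinAt ?_
    have c1 := (continuousAt_mul_arcsin_mobius hR hC1 hA0 hA
      (show x - M ≤ R by linarith [hx.2])).comp (f := fun x => x - M)
      (show ContinuousAt (fun x : ℝ => x - M) x by fun_prop)
    have c2 := (continuousAt_mul_arcsin_mobius hR hC2 hB0 hB
      (show M - x ≤ R by linarith [hx.1])).comp (f := fun x => M - x)
      (show ContinuousAt (fun x : ℝ => M - x) x by fun_prop)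
    have c0 : ContinuousAt (fun x : ℝ => Real.arcsin ((x - M) / R)) x :=
      (Real.continuous_arcsin.comp (by fun_prop)).continuousAt
    exact (continuousAt_const.mul ((c0.sub (continuousAt_const.mul c1)).add
      (continuousAt_const.mul c2))).add continuousAt_const
  · have e1 : M - R - M = -R := by ring
    have e2 : M - (M - R) = R := by ring
    have e3 : -R / R = -1 := by field_simp
    simp only [e1, e2, e3, m1, p2, Real.arcsin_neg_one]
    have := Real.pi_ne_zero
    field_simp
    linear_combination -hσ
  · have e1 : M + R - M = R := by ring
    have e2 : M - (M + R) = -R := by ring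
    have e3 : R / R = 1 := by field_simp
    simp only [e1, e2, e3, p1, m2, Real.arcsin_one]
    have := Real.pi_ne_zero
    field_simp
    linear_combination hσ
  · intro x hx
    have hX : 0 < R ^ 2 - (x - M) ^ 2 := by nlinarith [hx.1, hx.2]
    have hX' : 0 < R ^ 2 - (M - x) ^ 2 := by nlinarith
    have h1 : 0 < 1 - x := by linarith [hx.2]
    have h2 : 0 < 1 + x := by linarith [hx.1]
    have d0 := hasDerivAt_arcsin_linear hR hX
    have d1 := (hasDerivAt_mul_arcsin_mobius hR hA0 hA
      (show 0 < 1 - M - (x - M) by linarith) hX).comp x ((hasDerivAt_id x).sub_const M)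
    have d2 := (hasDerivAt_mul_arcsin_mobius hR hB0 hB
      (show 0 < 1 + M - (M - x) by linarith) hX').comp x ((hasDerivAt_id x).const_sub M)
    refine ((((d0.sub (d1.const_mul (1 / 2))).add (d2.const_mul (1 / 2))).const_mul
      (σ / (2 * Real.pi))).add_const (1 / 2)).congr_deriv ?_
    have e1 : (M + R - x) * (x - (M - R)) = R ^ 2 - (x - M) ^ 2 := by ring
    have e2 : R ^ 2 - (M - x) ^ 2 = R ^ 2 - (x - M) ^ 2 := by ring
    have e3 : 1 - M - (x - M) = 1 - x := by ring
    have e4 : 1 + M - (M - x) = 1 + x := by ring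
    have e5 : 1 - x ^ 2 = (1 - x) * (1 + x) := by ring
    rw [e1, e2, e3, e4, e5, hA, hB]
    have hsq := Real.sq_sqrt hX.le
    have hs := Real.sqrt_pos.mpr hX
    congr 1
    field_simp
    rw [hsq]
    ring

theorem scaledPotential_eq_sq {M R A B σ x : ℝ} (hA : A ^ 2 = (1 - M) ^ 2 - R ^ 2)
    (hB : B ^ 2 = (1 + M) ^ 2 - R ^ 2) (hσ : σ * (2 - A - B) = 4)
    (h1 : -1 < x) (h2 : x < 1) (hX : 0 ≤ (M + R - x) * (x - (M - R))) :
    scaledPotential (σ * A / 2) (σ * B / 2) 0 x =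
      (Real.pi * (σ / (2 * Real.pi) * (√((M + R - x) * (x - (M - R))) / (1 - x ^ 2)))) ^ 2 := by
  have hπ := Real.pi_ne_zero
  have e0 : Real.pi * (σ / (2 * Real.pi) * (√((M + R - x) * (x - (M - R))) / (1 - x ^ 2))) =
      σ / 2 * (√((M + R - x) * (x - (M - R))) / (1 - x ^ 2)) := by field_simp
  have e1 : 1 + σ * A / 2 + σ * B / 2 + 0 + (σ * A / 2 + 0) * (σ * B / 2 + 0) / 2 =
      σ ^ 2 / 4 * (1 - A ^ 2 / 4 - B ^ 2 / 4) := by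
    linear_combination (-(1 / 4) - σ * (2 - A - B) / 16 - σ * (A + B) / 8) * hσ
  have e5 : 1 - x ^ 2 = (1 - x) * (1 + x) := by ring
  have n1 : 1 - x ≠ 0 := by linarith
  have n2 : 1 + x ≠ 0 := by linarith
  rw [e0, mul_pow, div_pow σ, div_pow √_, Real.sq_sqrt hX, scaledPotential, e1, e5]
  have e6 : (0 : ℝ) ^ 2 - (σ * A / 2) ^ 2 = -(σ ^ 2 / 4 * A ^ 2) := by ring
  have e7 : (0 : ℝ) ^ 2 - (σ * B / 2) ^ 2 = -(σ ^ 2 / 4 * B ^ 2) := by ring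
  rw [e6, e7, hA, hB]
  field_simp
  ring

theorem stmt2 (α β : ℕ → ℝ) (a b : ℝ) (ha : 0 ≤ a) (hb : 0 ≤ b)
    (hα : ∀ n, α n > -1) (hβ : ∀ n, β n > -1)
    (hαlim : Tendsto (fun n : ℕ => α n / n) atTop (𝓝 a))
    (hβlim : Tendsto (fun n : ℕ => β n / n) atTop (𝓝 b))
    (r1 r2 : ℝ)
    (hr1 : r1 = (b ^ 2 - a ^ 2 - 4 * Real.sqrt ((a + 1) * (b + 1) * (a + b + 1))) /
      (2 + a + b) ^ 2)
    (hr2 : r2 = (b ^ 2 - a ^ 2 + 4 * Real.sqrt ((a + 1) * (b + 1) * (a + b + 1))) /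
      (2 + a + b) ^ 2)
    (ξ : ℝ) (hξ1 : r1 ≤ ξ) (hξ2 : ξ ≤ r2) :
    Tendsto (fun n : ℕ => (jacobiN n (α n) (β n) ξ : ℝ) / n) atTop
      (𝓝 ((2 + a + b) / (2 * Real.pi) *
        ∫ x in r1..ξ, Real.sqrt ((r2 - x) * (x - r1)) / (1 - x ^ 2))) := by
  obtain ⟨σ, hσdef⟩ : ∃ σ, σ = 2 + a + b := ⟨_, rfl⟩
  obtain ⟨M, hMdef⟩ : ∃ M, M = (b ^ 2 - a ^ 2) / σ ^ 2 := ⟨_, rfl⟩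
  obtain ⟨R, hRdef⟩ : ∃ R, R = 4 * √((a + 1) * (b + 1) * (a + b + 1)) / σ ^ 2 := ⟨_, rfl⟩
  have hσ0 : 0 < σ := by linarith
  have hpos : 0 < (a + 1) * (b + 1) * (a + b + 1) := by positivity
  have hR : 0 < R := by
    have := Real.sqrt_pos.mpr hpos
    rw [hRdef]
    positivity
  have hr1' : r1 = M - R := by rw [hr1, hMdef, hRdef, ← hσdef]; ring
  have hr2' : r2 = M + R := by rw [hr2, hMdef, hRdef, ← hσdef]; ring
  have hM1 : -1 < M := by
    rw [hMdef, lt_div_iff₀ (by positivity), hσdef]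
    nlinarith
  have hM2 : M < 1 := by
    rw [hMdef, div_lt_iff₀ (by positivity), hσdef]
    nlinarith
  have hR2 : R ^ 2 = 16 * ((a + 1) * (b + 1) * (a + b + 1)) / σ ^ 4 := by
    rw [hRdef, div_pow, mul_pow, Real.sq_sqrt hpos.le]
    ring
  have hA : (2 * a / σ) ^ 2 = (1 - M) ^ 2 - R ^ 2 := by
    rw [hR2, hMdef]
    field_simp
    rw [hσdef]
    ring
  have hB : (2 * b / σ) ^ 2 = (1 + M) ^ 2 - R ^ 2 := by
    rw [hR2, hMdef]
    field_simp
    rw [hσdef]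
    ring
  have hσ : σ * (2 - 2 * a / σ - 2 * b / σ) = 4 := by
    field_simp
    rw [hσdef]
    ring
  have haσ : σ * (2 * a / σ) / 2 = a := by field_simp
  have hbσ : σ * (2 * b / σ) / 2 = b := by field_simp
  have hl : -1 ≤ M - R := by nlinarith [sq_nonneg (2 * b / σ)]
  have hu : M + R ≤ 1 := by nlinarith [sq_nonneg (2 * a / σ)]
  rw [← hσdef]
  rw [hr1'] at hξ1 ⊢
  rw [hr2'] at hξ2 ⊢
  obtain ⟨G, hGc, hG0, hG1, hGd⟩ := exists_primitive_density hR hM1 hM2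
    (by positivity : 0 ≤ 2 * a / σ) (by positivity : 0 ≤ 2 * b / σ) hA hB hσ
  have hint : σ / (2 * Real.pi) * ∫ x in (M - R)..ξ, √((M + R - x) * (x - (M - R))) / (1 - x ^ 2)
      = G ξ := by
    have hGc' : ContinuousOn G (Set.Icc (M - R) ξ) :=
      hGc.mono (Set.Icc_subset_Icc_right hξ2)
    have hGd' : ∀ x ∈ Set.Ioo (M - R) ξ, HasDerivAt G
        (σ / (2 * Real.pi) * (√((M + R - x) * (x - (M - R))) / (1 - x ^ 2))) x :=
      fun x hx => hGd x ⟨hx.1, hx.2.trans_le hξ2⟩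
    rw [← intervalIntegral.integral_const_mul,
      intervalIntegral.integral_eq_sub_of_hasDerivAt_of_le hξ1 hGc' hGd', hG0, sub_zero]
    rw [intervalIntegrable_iff_integrableOn_Ioc_of_le hξ1]
    refine intervalIntegral.integrableOn_deriv_of_nonneg hGc' hGd' fun x hx => ?_
    have : 0 ≤ 1 - x ^ 2 := by nlinarith [hx.1, hx.2]
    have := Real.pi_pos
    positivity
  rw [hint]
  refine tendsto_div_of_increment_ge (N := fun n x => (jacobiN n (α n) (β n) x : ℝ))
    (fun n x y hxy => Nat.cast_le.mpr (jacobiN_mono n (hα n) (β n) hxy))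
    (fun n x => Nat.cast_nonneg _) (fun n x => Nat.cast_le.mpr (jacobiN_le n (hα n) (β n) x))
    hGc hG0 hG1 (fun c d hc hcd hd ε hε => ?_) ⟨hξ1, hξ2⟩
  have hin : Set.Icc c d ⊆ Set.Ioo (M - R) (M + R) := fun x hx =>
    ⟨hc.trans_le hx.1, hx.2.trans_lt hd⟩
  have hdc : 0 < d - c := by linarith
  have h := eventually_increment_ge_of_local
    (N := fun n x => (jacobiN n (α n) (β n) x : ℝ)) (G := G)
    (f := fun x => σ / (2 * Real.pi) * (√((M + R - x) * (x - (M - R))) / (1 - x ^ 2)))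
    (fun n x y hxy => Nat.cast_le.mpr (jacobiN_mono n (hα n) (β n) hxy)) hcd.le
    (fun x hx => hGd x (hin hx)) ?_ ?_ (div_pos hε hdc)
  · rwa [div_mul_cancel₀ _ hdc.ne'] at h
  · refine continuousOn_const.mul (ContinuousOn.div (by fun_prop) (by fun_prop) fun x hx => ?_)
    obtain ⟨h1, h2⟩ := hin hx
    have hlt : 0 < (1 - x) * (1 + x) := mul_pos (by linarith) (by linarith)
    have e : 1 - x ^ 2 = (1 - x) * (1 + x) := by ring
    exact e ▸ hlt.ne'
  · intro x₀ hx₀ μ hμ hlt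
    obtain ⟨h1, h2⟩ := hin hx₀
    have h1' : -1 < x₀ := by linarith
    have h2' : x₀ < 1 := by linarith
    refine jacobiN_local_lower_bound hα hαlim hβlim h1' h2' hμ ?_
    have hX : 0 ≤ (M + R - x₀) * (x₀ - (M - R)) :=
      mul_nonneg (by linarith) (by linarith)
    have he := scaledPotential_eq_sq hA hB hσ h1' h2' hX
    rw [haσ, hbσ] at he
    rw [he]
    have := Real.pi_pos
    exact pow_lt_pow_left₀ (mul_lt_mul_of_pos_left hlt this) (by positivity) two_ne_zero
end
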